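/- arXiv:1709.04567 — 4 statements merged into one kernel-verified Lean document; each statement's English description precedes it below -/
import Mathlib

section
/- There is a Borel function K : (2^ω)³ → 2^ω such that for every analytic set A ⊆ 2^ω admitting a Borel reduction of E_0 into E_0 ↾ A, the restriction of K to [A]³_{E_0} is not continuous. -/
open Set Function

/-- The eventual-agreement equivalence relation `E₀`. -/
def E0 {α : Type*} (x y : ℕ → α) : Prop := ∃ n, ∀ k > n, x k = y k

/-- `[B]³_{E₀}`: triples from `B` that are pairwise `E₀`-inequivalent. -/
def triplesE0 (B : Set (ℕ → Bool)) : Set ((ℕ → Bool) × (ℕ → Bool) × (ℕ → Bool)) :=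
  {p | p.1 ∈ B ∧ p.2.1 ∈ B ∧ p.2.2 ∈ B ∧
    ¬E0 p.1 p.2.1 ∧ ¬E0 p.1 p.2.2 ∧ ¬E0 p.2.1 p.2.2}

section E0Lemmas

variable {α : Type*} {x y z : ℕ → α}

theorem E0.symm (h : E0 x y) : E0 y x :=
  let ⟨n, hn⟩ := h
  ⟨n, fun k hk => (hn k hk).symm⟩

theorem E0.trans (h : E0 x y) (h' : E0 y z) : E0 x z :=
  let ⟨n, hn⟩ := h
  let ⟨m, hm⟩ := h'
  ⟨max n m, fun k hk => (hn k (by omega)).trans (hm k (by omega))⟩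

/-- The sequence that agrees with `a` below `n` and with `b` from `n` on. -/
def glue (n : ℕ) (a b : ℕ → α) : ℕ → α := fun k => if k < n then a k else b k

theorem glue_of_lt {n k : ℕ} (a b : ℕ → α) (h : k < n) : glue n a b k = a k := if_pos h

theorem glue_of_le {n k : ℕ} (a b : ℕ → α) (h : n ≤ k) : glue n a b k = b k :=
  if_neg (not_lt.2 h)

theorem E0_glue (n : ℕ) (a b : ℕ → α) : E0 b (glue n a b) :=
  ⟨n, fun _ hk => (glue_of_le a b hk.le).symm⟩

end E0Lemmas

theorem not_E0_not (x : ℕ → Bool) : ¬E0 x fun k => !x k := by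
  rintro ⟨n, hn⟩
  simpa using hn (n + 1) (Nat.lt_succ_self n)

/-- Negation of the coordinates in `F`, followed by negation of all coordinates if `b` holds. -/
def flipCoords (F : Finset ℕ) (b : Bool) (x : ℕ → Bool) : ℕ → Bool :=
  fun k => xor (x k) (xor b (decide (k ∈ F)))

theorem flipCoords_involutive (F : Finset ℕ) (b : Bool) : Involutive (flipCoords F b) := by
  intro x
  funext k
  simp [flipCoords]

theorem continuous_flipCoords (F : Finset ℕ) (b : Bool) : Continuous (flipCoords F b) :=
  continuous_pi fun k =>
    (continuous_of_discreteTopology (f := fun c : Bool => xor c (xor b (decide (k ∈ F))))).comp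
      (continuous_apply k)

/-- `flipCoords` as a homeomorphism. -/
def flipHomeomorph (F : Finset ℕ) (b : Bool) : (ℕ → Bool) ≃ₜ (ℕ → Bool) where
  toEquiv := (flipCoords_involutive F b).toPerm
  continuous_toFun := continuous_flipCoords F b
  continuous_invFun := continuous_flipCoords F b

theorem exists_flipCoords_of_E0 {x y : ℕ → Bool} (h : E0 x y) :
    ∃ F, flipCoords F false x = y := by
  obtain ⟨n, hn⟩ := h
  refine ⟨(Finset.range (n + 1)).filter fun k => x k ≠ y k, funext fun k => ?_⟩
  rcases le_or_gt k n with hk | hk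
  · simp only [flipCoords, Finset.mem_filter, Finset.mem_range, Nat.lt_succ_of_le hk]
    cases x k <;> cases y k <;> simp
  · simp [flipCoords, hn k hk]

theorem exists_flipCoords_of_E0_not {x y : ℕ → Bool} (h : E0 (fun k => !x k) y) :
    ∃ F, flipCoords F true x = y := by
  obtain ⟨F, rfl⟩ := exists_flipCoords_of_E0 h
  exact ⟨F, funext fun k => by simp [flipCoords]⟩

/-- A Borel self-map of Cantor space is continuous on a dense `Gδ` set. -/
theorem Measurable.exists_isGδ_dense_continuousOn {f : (ℕ → Bool) → (ℕ → Bool)}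
    (hf : Measurable f) : ∃ t, IsGδ t ∧ Dense t ∧ ContinuousOn f t := by
  have key : ∀ (k : ℕ) (b : Bool), ∃ U : Set (ℕ → Bool), IsOpen U ∧
      ∀ᶠ x in residual (ℕ → Bool), (f x k = b ↔ x ∈ U) := by
    intro k b
    have hm : MeasurableSet {x | f x k = b} :=
      (measurable_pi_iff.1 hf k) (measurableSet_singleton b)
    obtain ⟨U, hU, h⟩ := hm.residualEq_isOpen
    exact ⟨U, hU, h.mem_iff⟩
  choose U hU hfU using key
  have hres : ∀ᶠ x in residual (ℕ → Bool), ∀ k b, (f x k = b ↔ x ∈ U k b) :=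
    eventually_countable_forall.2 fun k => eventually_countable_forall.2 fun b => hfU k b
  obtain ⟨t, hts, ht, htd⟩ := mem_residual.1 hres
  refine ⟨t, ht, htd, continuousOn_pi.2 fun k x hx => ?_⟩
  have : U k (f x k) ∈ nhds x := (hU k _).mem_nhds ((hts hx k _).1 rfl)
  refine Filter.Tendsto.congr' (f₁ := fun _ => f x k) ?_ tendsto_const_nhds
  filter_upwards [mem_nhdsWithin_of_mem_nhds this, self_mem_nhdsWithin] with y hy hyt
  exact ((hts hyt k _).2 hy).symm

/-- A Borel self-map of Cantor space is continuous on a dense `Gδ` set that is invariant under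
`E₀` and under coordinatewise negation. -/
theorem Measurable.exists_invariant_isGδ_dense_continuousOn {f : (ℕ → Bool) → (ℕ → Bool)}
    (hf : Measurable f) : ∃ D, IsGδ D ∧ Dense D ∧ ContinuousOn f D ∧
      (∀ x ∈ D, ∀ y, E0 x y → y ∈ D) ∧ ∀ x ∈ D, (fun k => !x k) ∈ D := by
  obtain ⟨t, ht, htd, hc⟩ := hf.exists_isGδ_dense_continuousOn
  have hmem : ∀ x, x ∈ ⋂ p : Finset ℕ × Bool, flipCoords p.1 p.2 ⁻¹' t ↔
      ∀ y, E0 x y ∨ E0 (fun k => !x k) y → y ∈ t := by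
    intro x
    simp only [mem_iInter, Prod.forall, mem_preimage]
    constructor
    · rintro h y (hy | hy)
      · obtain ⟨F, rfl⟩ := exists_flipCoords_of_E0 hy
        exact h F false
      · obtain ⟨F, rfl⟩ := exists_flipCoords_of_E0_not hy
        exact h F true
    · intro h F b
      refine h _ ?_
      have hF : ∃ n, ∀ k > n, k ∉ F :=
        ⟨F.sup id, fun k hk hkF => hk.not_ge (Finset.le_sup (f := id) hkF)⟩
      obtain ⟨n, hn⟩ := hF
      cases b
      · exact Or.inl ⟨n, fun k hk => by simp [flipCoords, hn k hk]⟩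
      · exact Or.inr ⟨n, fun k hk => by simp [flipCoords, hn k hk]⟩
  have hnot : ∀ {x y : ℕ → Bool}, E0 x y → E0 (fun k => !x k) fun k => !y k :=
    fun ⟨n, hn⟩ => ⟨n, fun k hk => congrArg (fun c => !c) (hn k hk)⟩
  refine ⟨⋂ p : Finset ℕ × Bool, flipCoords p.1 p.2 ⁻¹' t,
    .iInter fun p => ht.preimage (continuous_flipCoords _ _),
    dense_iInter_of_Gδ (fun p => ht.preimage (continuous_flipCoords _ _))
      fun p => htd.preimage (f := flipCoords p.1 p.2) (flipHomeomorph p.1 p.2).isOpenMap,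
    hc.mono fun x hx => (hmem x).1 hx x (Or.inl ⟨0, fun _ _ => rfl⟩), ?_, ?_⟩
  · intro x hx y hxy
    rw [hmem] at hx ⊢
    rintro z (h | h)
    · exact hx z (Or.inl (hxy.trans h))
    · exact hx z (Or.inr ((hnot hxy).trans h))
  · intro x hx
    rw [hmem] at hx ⊢
    rintro z (h | h)
    · exact hx z (Or.inr h)
    · exact hx z (Or.inl (by simpa using h))

theorem IsOpen.exists_forall_lt_eq_mem {O : Set (ℕ → Bool)} (hO : IsOpen O) {x : ℕ → Bool}
    (hx : x ∈ O) : ∃ N, ∀ y : ℕ → Bool, (∀ k < N, y k = x k) → y ∈ O := by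
  obtain ⟨_, ⟨z, n, rfl⟩, hxz, hsub⟩ :=
    (PiNat.isTopologicalBasis_cylinders fun _ => Bool).exists_subset_of_mem_open hx hO
  exact ⟨n, fun y hy => hsub fun k hk => (hy k hk).trans (hxz k hk)⟩

theorem ContinuousOn.exists_forall_lt_eq {f : (ℕ → Bool) → (ℕ → Bool)} {D : Set (ℕ → Bool)}
    (hc : ContinuousOn f D) {x : ℕ → Bool} (hx : x ∈ D) (m : ℕ) :
    ∃ N, ∀ y ∈ D, (∀ k < N, y k = x k) → ∀ k < m, f y k = f x k := by
  have h : ∀ᶠ y in nhdsWithin x D, ∀ k ∈ Iio m, f y k = f x k :=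
    (Filter.eventually_all_finite (finite_Iio m)).2 fun k _ =>
      continuousOn_pi.1 hc k x hx ((isOpen_discrete {f x k}).mem_nhds rfl)
  obtain ⟨u, hu, hxu, hsub⟩ := mem_nhdsWithin.1 h
  obtain ⟨N, hN⟩ := hu.exists_forall_lt_eq_mem hxu
  exact ⟨N, fun y hy hyx => hsub ⟨hN y hyx, hy⟩⟩

theorem continuous_glue (n : ℕ) (a : ℕ → Bool) : Continuous (glue n a) := by
  refine continuous_pi fun k => ?_
  by_cases h : k < n
  · simpa [glue, h] using continuous_const
  · simpa [glue, h] using continuous_apply k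

/-- Baire category: if `f` is an `E₀`-homomorphism, then on some cylinder the values of `f` at
the sequences obtained by replacing the first `n` coordinates by those of `s l` agree from a
uniform point on. -/
theorem exists_cylinder_agree {f : (ℕ → Bool) → (ℕ → Bool)} {D : Set (ℕ → Bool)} (hG : IsGδ D)
    (hd : Dense D) (hc : ContinuousOn f D) (hinv : ∀ x ∈ D, ∀ y, E0 x y → y ∈ D)
    (hf : ∀ x y, E0 x y → E0 (f x) (f y)) {ι : Type*} [Finite ι] (s : ι → ℕ → Bool) (n : ℕ) :
    ∃ M N, ∃ z ∈ D, ∀ y ∈ D, (∀ k < N, y k = z k) → ∀ l l', ∀ k ≥ M,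
      f (glue n (s l) y) k = f (glue n (s l') y) k := by
  have hglue : ∀ l, ∀ y ∈ D, glue n (s l) y ∈ D := fun l y hy => hinv y hy _ (E0_glue _ _ _)
  let F : ℕ → Set (ℕ → Bool) := fun M =>
    {y | y ∈ D ∧ ∀ l l', ∀ k ≥ M, f (glue n (s l) y) k = f (glue n (s l') y) k}
  have hcover : D ⊆ ⋃ M, closure (F M) := by
    intro y hy
    have h1 : ∀ p : ι × ι, E0 (f (glue n (s p.1) y)) (f (glue n (s p.2) y)) := fun p =>
      hf _ _ ((E0_glue n (s p.1) y).symm.trans (E0_glue n (s p.2) y))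
    choose N hN using h1
    obtain ⟨M, hM⟩ := (Set.finite_range N).bddAbove
    refine mem_iUnion.2 ⟨M + 1, subset_closure ⟨hy, fun l l' k hk => hN (l, l') k ?_⟩⟩
    have := hM (mem_range_self (l, l'))
    omega
  have hdense := hG.dense_iUnion_interior_of_closed hd (fun M => isClosed_closure) hcover
  obtain ⟨z, hz, hzD⟩ := hd.inter_open_nonempty _ (isOpen_iUnion fun M => isOpen_interior)
    hdense.nonempty
  obtain ⟨M, hzM⟩ := mem_iUnion.1 hz
  obtain ⟨N, hN⟩ := isOpen_interior.exists_forall_lt_eq_mem hzM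
  refine ⟨M, N, z, hzD, fun y hy hyz l l' k hk => ?_⟩
  have hcl : y ∈ closure (F M) := interior_subset (hN y hyz)
  have hcont : ∀ l, ContinuousOn (fun y => f (glue n (s l) y) k) D := fun l =>
    (continuousOn_pi.1 hc k).comp (continuous_glue n (s l)).continuousOn (hglue l)
  have : (nhdsWithin y (F M)).NeBot := mem_closure_iff_nhdsWithin_neBot.1 hcl
  have hsub : F M ⊆ D := fun y hy => hy.1
  have t1 := ((hcont l) y hy).mono_left (nhdsWithin_mono y hsub)
  have t2 := ((hcont l') y hy).mono_left (nhdsWithin_mono y hsub)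
  refine tendsto_nhds_unique (t1.congr' ?_) t2
  filter_upwards [self_mem_nhdsWithin] with w hw
  exact hw.2 l l' k hk

/-- A finite approximation to a triple of sequences: only the first `n` coordinates of the
sequences `s l` matter. They decide the first `m` coordinates of `f`, and `f` does not depend
on them from `m` on. -/
structure Approx (f : (ℕ → Bool) → (ℕ → Bool)) (D : Set (ℕ → Bool)) where
  /-- The length of the approximation. -/
  n : ℕ
  /-- The length of the part of the values of `f` that is decided. -/
  m : ℕ
  /-- The three sequences. -/
  s : Fin 3 → ℕ → Bool
  agree : ∀ x ∈ D, ∀ x' ∈ D, ∀ l l', (∀ k < n, x k = s l k) → (∀ k < n, x' k = s l' k) →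
    (∀ k ≥ n, x k = x' k) → ∀ k ≥ m, f x k = f x' k
  decides : ∀ x ∈ D, ∀ x' ∈ D, ∀ l, (∀ k < n, x k = s l k) → (∀ k < n, x' k = s l k) →
    ∀ k < m, f x k = f x' k

/-- `S'` extends `S`, forces its sequences into `O`, and makes the `i`-th value of `f` the odd
one out between `S.m` and `S'.m`. -/
structure Approx.Extends {f : (ℕ → Bool) → (ℕ → Bool)} {D : Set (ℕ → Bool)} (S S' : Approx f D)
    (O : Set (ℕ → Bool)) (i : Fin 3) : Prop where
  n_lt : S.n < S'.n
  m_lt : S.m < S'.m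
  s_eq : ∀ l, ∀ k < S.n, S'.s l k = S.s l k
  mem : ∀ l, ∀ y : ℕ → Bool, (∀ k < S'.n, y k = S'.s l k) → y ∈ O
  same : ∀ x : Fin 3 → ℕ → Bool, (∀ l, x l ∈ D) → (∀ l, ∀ k < S'.n, x l k = S'.s l k) →
    ∀ k, S.m ≤ k → k < S'.m → ∀ l l', l ≠ i → l' ≠ i → f (x l) k = f (x l') k
  diff : ∀ x : Fin 3 → ℕ → Bool, (∀ l, x l ∈ D) → (∀ l, ∀ k < S'.n, x l k = S'.s l k) →
    ∃ k, S.m ≤ k ∧ k < S'.m ∧ ∀ l, l ≠ i → f (x l) k ≠ f (x i) k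

theorem Approx.exists_extends {f : (ℕ → Bool) → (ℕ → Bool)} {D : Set (ℕ → Bool)} (hG : IsGδ D)
    (hd : Dense D) (hc : ContinuousOn f D) (hinv : ∀ x ∈ D, ∀ y, E0 x y → y ∈ D)
    (hneg : ∀ x ∈ D, (fun k => !x k) ∈ D) (hf : ∀ x y, E0 x y ↔ E0 (f x) (f y))
    {O : Set (ℕ → Bool)} (hO : IsOpen O) (hDO : D ⊆ O) (S : Approx f D) (i : Fin 3) :
    ∃ S', S.Extends S' O i := by
  obtain ⟨n, m, s, agree, -⟩ := S
  obtain ⟨w, hw⟩ := hd.nonempty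
  have hglue : ∀ n a, ∀ y ∈ D, glue n a y ∈ D := fun n a y hy => hinv y hy _ (E0_glue _ _ _)
  set w' : ℕ → Bool := fun k => !w k
  have hw' : w' ∈ D := hneg w hw
  have hne : ¬E0 (f (glue n (s i) w)) (f (glue n (s i) w')) := by
    rw [← hf]
    exact fun h => not_E0_not w
      ((E0_glue n (s i) w).trans (h.trans (E0_glue n (s i) w').symm))
  obtain ⟨k₀, hk₀, hk₀ne⟩ : ∃ k > m, f (glue n (s i) w) k ≠ f (glue n (s i) w') k := by
    by_contra! h
    exact hne ⟨m, h⟩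
  obtain ⟨N₁, hN₁⟩ := hc.exists_forall_lt_eq (hglue n (s i) w hw) (k₀ + 1)
  obtain ⟨N₂, hN₂⟩ := hc.exists_forall_lt_eq (hglue n (s i) w' hw') (k₀ + 1)
  obtain ⟨n₁, hn₁, hn₁₁, hn₁₂⟩ : ∃ n₁, n ≤ n₁ ∧ N₁ ≤ n₁ ∧ N₂ ≤ n₁ :=
    ⟨max n (max N₁ N₂), by omega, by omega, by omega⟩
  let s₁ : Fin 3 → ℕ → Bool := fun l => glue n (s l) (if l = i then w' else w)
  obtain ⟨M, n₂, z, hz, hzM⟩ :=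
    exists_cylinder_agree hG hd hc hinv (fun x y => (hf x y).1) s₁ n₁
  let s' : Fin 3 → ℕ → Bool := fun l => glue n₁ (s₁ l) z
  have hs' : ∀ l, s' l ∈ D := fun l => hglue _ _ z hz
  let m' := max M (k₀ + 1)
  choose N₃ hN₃ using fun l => hc.exists_forall_lt_eq (hs' l) m'
  choose N₄ hN₄ using fun l => hO.exists_forall_lt_eq_mem (hDO (hs' l))
  obtain ⟨n', hn₁', hn₂', hn₃', hn₄'⟩ : ∃ n', n₁ < n' ∧ n₂ ≤ n' ∧ (∀ l, N₃ l ≤ n') ∧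
      ∀ l, N₄ l ≤ n' := by
    refine ⟨n₁ + n₂ + ∑ l, N₃ l + ∑ l, N₄ l + 1, by omega, by omega, fun l => ?_, fun l => ?_⟩
    · have := Finset.single_le_sum (fun l _ => Nat.zero_le (N₃ l)) (Finset.mem_univ l)
      omega
    · have := Finset.single_le_sum (fun l _ => Nat.zero_le (N₄ l)) (Finset.mem_univ l)
      omega
  have hdec : ∀ l, ∀ x ∈ D, (∀ k < n', x k = s' l k) → ∀ k < m', f x k = f (s' l) k :=
    fun l x hx h => hN₃ l x hx fun k hk => h k (hk.trans_le (hn₃' l))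
  have hs'n : ∀ l, ∀ k < n, s' l k = s l k := fun l k hk => by
    simp only [s', s₁, glue_of_lt _ _ hk, glue_of_lt _ _ (hk.trans_le hn₁)]
  refine ⟨⟨n', m', s', ?_, ?_⟩, ?_⟩
  · intro x hx x' hx' l l' hxl hxl' hxx' k hk
    have hy : glue n' z x ∈ D := hglue _ _ x hx
    have key : ∀ l, ∀ x', (∀ k < n', x' k = s' l k) → (∀ k ≥ n', x k = x' k) →
        x' = glue n₁ (s₁ l) (glue n' z x) := by
      intro l x' h h'
      funext k
      rcases lt_or_ge k n₁ with hk₁ | hk₁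
      · rw [h k (hk₁.trans hn₁'), glue_of_lt _ _ hk₁]
        exact glue_of_lt _ _ hk₁
      · rw [glue_of_le _ _ hk₁]
        rcases lt_or_ge k n' with hk₂ | hk₂
        · rw [h k hk₂, glue_of_lt _ _ hk₂]
          exact glue_of_le _ _ hk₁
        · rw [glue_of_le _ _ hk₂, h' k hk₂]
    rw [key l x hxl fun _ _ => rfl, key l' x' hxl' hxx']
    exact hzM _ hy (fun k hk => glue_of_lt _ _ (hk.trans_le hn₂')) l l' k
      ((le_max_left _ _).trans hk)
  · intro x hx x' hx' l h h' k hk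
    rw [hdec l x hx h k hk, hdec l x' hx' h' k hk]
  · refine ⟨hn₁.trans_lt hn₁', ?_, hs'n, fun l y hy => hN₄ l y fun k hk =>
      hy k (hk.trans_le (hn₄' l)), ?_, ?_⟩
    · exact lt_max_of_lt_right (hk₀.trans (Nat.lt_succ_self k₀))
    · intro x hx hxs k hk hk' l l' hl hl'
      rw [hdec l _ (hx l) (hxs l) k hk', hdec l' _ (hx l') (hxs l') k hk']
      refine agree _ (hs' l) _ (hs' l') l l' (hs'n l) (hs'n l') (fun j hj => ?_) k hk
      simp only [s', s₁, glue, if_neg hl, if_neg hl', if_neg (not_lt.2 hj)]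
    · intro x hx hxs
      have hk' : k₀ < m' := lt_max_of_lt_right (Nat.lt_succ_self _)
      refine ⟨k₀, hk₀.le, hk', fun l hl => ?_⟩
      rw [hdec l _ (hx l) (hxs l) k₀ hk', hdec i _ (hx i) (hxs i) k₀ hk']
      have hY : glue n (s i) (glue n₁ w z) ∈ D := hglue _ _ _ (hglue _ _ z hz)
      have e₁ : f (s' l) k₀ = f (glue n (s i) (glue n₁ w z)) k₀ := by
        refine agree _ (hs' l) _ hY l i (hs'n l) (fun j hj => glue_of_lt _ _ hj)
          (fun j hj => ?_) k₀ hk₀.le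
        simp only [s', s₁, glue, if_neg hl, if_neg (not_lt.2 hj)]
      have e₂ : f (glue n (s i) (glue n₁ w z)) k₀ = f (glue n (s i) w) k₀ := by
        refine hN₁ _ hY (fun j hj => ?_) k₀ (Nat.lt_succ_self _)
        simp only [glue, if_pos (hj.trans_le hn₁₁)]
      have e₃ : f (s' i) k₀ = f (glue n (s i) w') k₀ := by
        refine hN₂ _ (hs' i) (fun j hj => ?_) k₀ (Nat.lt_succ_self _)
        simp only [s', s₁, glue, if_pos (hj.trans_le hn₁₂), if_true]
      rw [e₁, e₂, e₃]
      exact hk₀ne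

/-- From a Borel reduction `f` of `E₀` to itself one obtains, continuously in a pattern
`p : ℕ → Fin 3`, triples of values of `f` such that on the `j`-th of a sequence of consecutive
blocks the `p j`-th value is the odd one out. -/
theorem exists_triple_of_pattern {f : (ℕ → Bool) → (ℕ → Bool)} (hfm : Measurable f)
    (hf : ∀ x y, E0 x y ↔ E0 (f x) (f y)) :
    ∃ (a : (ℕ → Fin 3) → Fin 3 → ℕ → Bool) (m : (ℕ → Fin 3) → ℕ → ℕ),
      (∀ p l, a p l ∈ range f) ∧ (∀ p, m p 0 = 0) ∧ (∀ p, StrictMono (m p)) ∧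
      (∀ p j k, m p j ≤ k → k < m p (j + 1) → ∀ l l', l ≠ p j → l' ≠ p j → a p l k = a p l' k) ∧
      (∀ p j, ∃ k, m p j ≤ k ∧ k < m p (j + 1) ∧ ∀ l, l ≠ p j → a p l k ≠ a p (p j) k) ∧
      ∀ p q N, (∀ j < N, p j = q j) → ∀ l, ∀ k < N, a p l k = a q l k := by
  obtain ⟨D, hG, hd, hc, hinv, hneg⟩ := hfm.exists_invariant_isGδ_dense_continuousOn
  obtain ⟨O, hO, hDO⟩ := isGδ_iff_eq_iInter_nat.1 hG
  have hDsub : ∀ j, D ⊆ O j := fun j => hDO ▸ iInter_subset O j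
  choose next hnext using fun (j : ℕ) (S : Approx f D) (i : Fin 3) =>
    S.exists_extends hG hd hc hinv hneg hf (hO j) (hDsub j) i
  let S₀ : Approx f D :=
    { n := 0
      m := 0
      s := fun _ _ => false
      agree := fun x _ x' _ _ _ _ _ h k _ => by
        rw [show x = x' from funext fun k => h k (Nat.zero_le k)]
      decides := fun _ _ _ _ _ _ _ k hk => absurd hk (Nat.not_lt_zero k) }
  let S : (ℕ → Fin 3) → ℕ → Approx f D := fun p j => Nat.rec S₀ (fun j T => next j T (p j)) j
  have hS : ∀ p j, (S p j).Extends (S p (j + 1)) (O j) (p j) := fun p j => hnext _ _ _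
  have hn : ∀ p, StrictMono fun j => (S p j).n := fun p => strictMono_nat_of_lt_succ fun j =>
    (hS p j).n_lt
  have hm : ∀ p, StrictMono fun j => (S p j).m := fun p => strictMono_nat_of_lt_succ fun j =>
    (hS p j).m_lt
  have hs : ∀ p l i j, i ≤ j → ∀ k < (S p i).n, (S p j).s l k = (S p i).s l k := by
    intro p l i j hij
    induction j, hij using Nat.le_induction with
    | base => exact fun _ _ => rfl
    | succ j hij ih =>
      intro k hk
      rw [(hS p j).s_eq l k (hk.trans_le ((hn p).monotone hij)), ih k hk]
  let x : (ℕ → Fin 3) → Fin 3 → ℕ → Bool := fun p l k => (S p (k + 1)).s l k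
  have hx : ∀ p l j, ∀ k < (S p j).n, x p l k = (S p j).s l k := by
    intro p l j k hk
    rcases le_total j (k + 1) with h | h
    · exact hs p l j _ h k hk
    · exact (hs p l _ j h k ((Nat.lt_succ_self k).trans_le ((hn p).le_apply))).symm
  have hxD : ∀ p l, x p l ∈ D := fun p l => by
    rw [hDO]
    exact mem_iInter.2 fun j => (hS p j).mem l _ (hx p l (j + 1))
  refine ⟨fun p l => f (x p l), fun p j => (S p j).m, fun p l => mem_range_self _, fun p => rfl,
    hm, fun p j k hk hk' => (hS p j).same (x p) (hxD p) (fun l => hx p l (j + 1)) k hk hk',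
    fun p j => (hS p j).diff (x p) (hxD p) fun l => hx p l (j + 1), ?_⟩
  intro p q N hpq l k hk
  have hSN : ∀ j ≤ N, S p j = S q j := by
    intro j
    induction j with
    | zero => exact fun _ => rfl
    | succ j ih =>
      intro hj
      change next j (S p j) (p j) = next j (S q j) (q j)
      rw [ih (by omega), hpq j (by omega)]
  refine (S p N).decides _ (hxD p l) _ (hxD q l) l (hx p l N) ?_ k (hk.trans_le (hm p).le_apply)
  rw [hSN N le_rfl]
  exact hx q l N

/-- The second sequence of the triple is the odd one out infinitely often. -/
def oddOftenSet : Set ((ℕ → Bool) × (ℕ → Bool) × (ℕ → Bool)) :=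
  {p | ∀ n, ∃ k ≥ n, p.1 k = p.2.2 k ∧ p.2.1 k ≠ p.1 k}

theorem measurableSet_oddOftenSet : MeasurableSet oddOftenSet := by
  have h1 : ∀ k, Measurable fun p : (ℕ → Bool) × (ℕ → Bool) × (ℕ → Bool) => p.1 k := fun k =>
    (measurable_pi_apply k).comp measurable_fst
  have h2 : ∀ k, Measurable fun p : (ℕ → Bool) × (ℕ → Bool) × (ℕ → Bool) => p.2.1 k := fun k =>
    (measurable_pi_apply k).comp (measurable_fst.comp measurable_snd)
  have h3 : ∀ k, Measurable fun p : (ℕ → Bool) × (ℕ → Bool) × (ℕ → Bool) => p.2.2 k := fun k =>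
    (measurable_pi_apply k).comp (measurable_snd.comp measurable_snd)
  have : oddOftenSet = ⋂ n, ⋃ k, ⋃ (_ : k ≥ n),
      ({p | p.1 k = p.2.2 k} ∩ {p | p.2.1 k = p.1 k}ᶜ) := by
    ext p
    simp [oddOftenSet, and_left_comm]
  rw [this]
  exact .iInter fun n => .iUnion fun k => .iUnion fun _ =>
    (measurableSet_eq_fun (h1 k) (h3 k)).inter (measurableSet_eq_fun (h2 k) (h1 k)).compl

/-- There is a Borel `K : (2^ω)³ → 2^ω` whose restriction to `[A]³_{E₀}` is not continuous,
for every analytic `A ⊆ 2^ω` into which `E₀` Borel-reduces. -/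
theorem exists_borel_K_not_continuous :
    ∃ K : (ℕ → Bool) × (ℕ → Bool) × (ℕ → Bool) → (ℕ → Bool), Measurable K ∧
      ∀ A : Set (ℕ → Bool), MeasureTheory.AnalyticSet A →
        (∃ f : (ℕ → Bool) → (ℕ → Bool),
          Measurable f ∧ range f ⊆ A ∧ ∀ x y, E0 x y ↔ E0 (f x) (f y)) →
        ¬ContinuousOn K (triplesE0 A) := by
  classical
  refine ⟨oddOftenSet.piecewise (fun _ _ => true) fun _ _ => false,
    .piecewise measurableSet_oddOftenSet measurable_const measurable_const, ?_⟩
  rintro A - ⟨f, hfm, hfA, hf⟩ hK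
  obtain ⟨a, m, ha, hm0, hm, hsame, hdiff, hcont⟩ := exists_triple_of_pattern hfm hf
  have hinequiv : ∀ p i l, l ≠ i → (∀ n, ∃ j ≥ n, p j = i) → ¬E0 (a p i) (a p l) := by
    rintro p i l hl hi ⟨n, hn⟩
    obtain ⟨j, hj, rfl⟩ := hi (n + 1)
    obtain ⟨k, hk, -, hkne⟩ := hdiff p j
    have : j ≤ m p j := (hm p).le_apply
    exact hkne l hl (hn k (by omega)).symm
  let tri : (ℕ → Fin 3) → (ℕ → Bool) × (ℕ → Bool) × (ℕ → Bool) := fun p =>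
    (a p 0, a p 1, a p 2)
  let p₀ : ℕ → Fin 3 := fun j => if Even j then 0 else 2
  let p : ℕ → ℕ → Fin 3 := fun N j => if Even j then 0 else if j < N then 2 else 1
  have hp0 : tri p₀ ∈ triplesE0 A := by
    have h0 : ∀ n, ∃ j ≥ n, p₀ j = 0 := fun n => ⟨2 * n, by omega, by simp [p₀]⟩
    have h2 : ∀ n, ∃ j ≥ n, p₀ j = 2 := fun n => ⟨2 * n + 1, by omega, by simp [p₀]⟩
    exact ⟨hfA (ha _ _), hfA (ha _ _), hfA (ha _ _), hinequiv _ 0 1 (by decide) h0,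
      hinequiv _ 0 2 (by decide) h0, fun h => hinequiv _ 2 1 (by decide) h2 h.symm⟩
  have hp1 : ∀ N n, ∃ j ≥ n, p N j = 1 := fun N n =>
    ⟨2 * (n + N) + 1, by omega, by simp [p]; omega⟩
  have hp : ∀ N, tri (p N) ∈ triplesE0 A := by
    intro N
    have h0 : ∀ n, ∃ j ≥ n, p N j = 0 := fun n => ⟨2 * n, by omega, by simp [p]⟩
    exact ⟨hfA (ha _ _), hfA (ha _ _), hfA (ha _ _), hinequiv _ 0 1 (by decide) h0,
      hinequiv _ 0 2 (by decide) h0, hinequiv _ 1 2 (by decide) (hp1 N)⟩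
  have hnot : tri p₀ ∉ oddOftenSet := by
    intro h
    obtain ⟨k, -, h1, h2⟩ := h 0
    obtain ⟨j, hj, hj'⟩ : ∃ j, m p₀ j ≤ k ∧ k < m p₀ (j + 1) := by
      have hex : ∃ j, k < m p₀ j := ⟨k + 1, (hm p₀).le_apply⟩
      obtain ⟨j, hj⟩ : ∃ j, Nat.find hex = j + 1 :=
        Nat.exists_eq_succ_of_ne_zero fun h => by
          have := Nat.find_spec hex
          rw [h, hm0] at this
          omega
      exact ⟨j, not_lt.1 (Nat.find_min hex (by omega)), hj ▸ Nat.find_spec hex⟩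
    by_cases hpar : Even j
    · have : p₀ j = 0 := if_pos hpar
      exact h2 ((hsame p₀ j k hj hj' 1 2 (by simp [this]) (by simp [this])).trans h1.symm)
    · have : p₀ j = 2 := if_neg hpar
      exact h2 (hsame p₀ j k hj hj' 1 0 (by simp [this]) (by simp [this]))
  have hodd : ∀ N, tri (p N) ∈ oddOftenSet := by
    intro N n
    obtain ⟨j, hj, hpj⟩ := hp1 N n
    obtain ⟨k, hk, hk', hkne⟩ := hdiff (p N) j
    have : j ≤ m (p N) j := (hm _).le_apply
    refine ⟨k, by omega, hsame _ j k hk hk' 0 2 (by simp [hpj]) (by simp [hpj]), ?_⟩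
    have := hkne 0 (by simp [hpj])
    rw [hpj] at this
    exact this.symm
  have htend : Filter.Tendsto (fun N => tri (p N)) Filter.atTop
      (nhdsWithin (tri p₀) (triplesE0 A)) := by
    refine tendsto_nhdsWithin_iff.2 ⟨?_, .of_forall hp⟩
    have key : ∀ l, Filter.Tendsto (fun N => a (p N) l) Filter.atTop (nhds (a p₀ l)) := by
      refine fun l => tendsto_pi_nhds.2 fun k => tendsto_const_nhds.congr' ?_
      filter_upwards [Filter.eventually_gt_atTop k] with N hN
      exact (hcont (p N) p₀ N (fun j hj => by simp [p, p₀, hj]) l k hN).symm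
    exact (key 0).prodMk_nhds ((key 1).prodMk_nhds (key 2))
  have hlim := tendsto_pi_nhds.1 ((hK _ hp0).tendsto.comp htend) 0
  simp only [comp_def, piecewise_eq_of_mem _ _ _ (hodd _),
    piecewise_eq_of_notMem _ _ _ hnot] at hlim
  exact Bool.noConfusion (tendsto_nhds_unique hlim tendsto_const_nhds)
end

section
/- Let A = {x ∈ 3^ω : ∀n, x(n) ≠ x(n+1)}. There is a continuous function P : [2^ω]³_{E_0} → A such that: (a) P[[range Φ]³_{E_0}] = A for every E_0-tree map Φ; and (b) P is E_0-to-E³_tail invariant: whenever (x,y,z) and (x',y',z') are triples of pairwise E_0-inequivalent elements of 2^ω with x E_0 x', y E_0 y', and z E_0 z', one has P(x,y,z) E³_tail P(x',y',z'). -/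
open Set Function

/-- The tail equivalence relation `E_tail` on `n^ω`: `x E_tail y` iff
`∃ r s ∀ a, x (r+a) = y (s+a)`. -/
def Etail {α : Type*} (x y : ℕ → α) : Prop := ∃ r s, ∀ a, x (r + a) = y (s + a)

/-- The finite initial segment `s ⌢ v 0 (x 0) ⌢ ⋯ ⌢ v (n-1) (x (n-1))`. -/
def blockPrefix (s : List Bool) (v : ℕ → Bool → List Bool) (x : ℕ → Bool) : ℕ → List Bool
  | 0 => s
  | n + 1 => blockPrefix s v x n ++ v n (x n)

/-- The map `x ↦ s ⌢ v 0 (x 0) ⌢ v 1 (x 1) ⌢ ⋯` determined by a stem `s` and blocks `v`. -/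
def e0TreeMapOf (s : List Bool) (v : ℕ → Bool → List Bool) (x : ℕ → Bool) : ℕ → Bool :=
  fun m => (blockPrefix s v x (m + 1)).getD m false

/-- Conditions on the blocks of an `E₀`-tree. -/
def IsE0Blocks (v : ℕ → Bool → List Bool) : Prop :=
  (∀ n i, (v n i).head? = some i) ∧ ∀ n, (v n false).length = (v n true).length

/-- `Φ` is an `E₀`-tree map. -/
def IsE0TreeMap (Φ : (ℕ → Bool) → (ℕ → Bool)) : Prop :=
  ∃ s v, IsE0Blocks v ∧ Φ = e0TreeMapOf s v

/-- `A = {x ∈ 3^ω : ∀ n, x n ≠ x (n+1)}`. -/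
def A3 : Set (ℕ → Fin 3) := {x | ∀ n, x n ≠ x (n + 1)}

/-- The most recent defined value of `c` strictly before time `n`. -/
def lastSome {α : Type*} (c : ℕ → Option α) : ℕ → Option α
  | 0 => none
  | n + 1 => (c n).or (lastSome c n)

/-- The most recent defined value of `c` changes at time `n`. -/
def IsSwitch {α : Type*} (c : ℕ → Option α) (n : ℕ) : Prop :=
  lastSome c (n + 1) ≠ lastSome c n

instance {α : Type*} [DecidableEq α] (c : ℕ → Option α) : DecidablePred (IsSwitch c) :=
  fun _ => inferInstanceAs (Decidable (_ ≠ _))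

/-- The sequence of defined values of `c`, with consecutive repetitions removed. -/
noncomputable def switchSeq {α : Type*} [Inhabited α] (c : ℕ → Option α) (k : ℕ) : α :=
  (lastSome c (Nat.nth (IsSwitch c) k + 1)).getD default

section Switch

variable {α : Type*}

lemma lastSome_eq_of_forall_not_isSwitch {c : ℕ → Option α} {m n : ℕ} (hmn : m ≤ n)
    (h : ∀ i, m ≤ i → i < n → ¬IsSwitch c i) : lastSome c n = lastSome c m := by
  induction n, hmn using Nat.le_induction with
  | base => rfl
  | succ n hmn ih =>
    rw [← ih fun i hi hin => h i hi (by omega)]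
    exact not_not.1 (h n hmn (by omega))

lemma lastSome_ne_none_of_isSwitch {c : ℕ → Option α} {n : ℕ} (h : IsSwitch c n) :
    lastSome c (n + 1) ≠ none := by
  intro h0
  apply h
  rw [h0]
  simp only [lastSome, Option.or_eq_none_iff] at h0
  exact h0.2.symm

lemma lastSome_congr {c d : ℕ → Option α} {n : ℕ} (h : ∀ i < n, c i = d i) :
    ∀ m ≤ n, lastSome c m = lastSome d m := by
  intro m
  induction m with
  | zero => intro _; rfl
  | succ m ih =>
    intro hm
    simp only [lastSome]
    rw [h m (by omega), ih (by omega)]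

lemma switchSeq_succ_ne [Inhabited α] {c : ℕ → Option α} (hc : (Set.ofPred (IsSwitch c)).Infinite)
    (k : ℕ) : switchSeq c k ≠ switchSeq c (k + 1) := by
  have h1 : IsSwitch c (Nat.nth (IsSwitch c) k) := Nat.nth_mem_of_infinite hc k
  have h2 : IsSwitch c (Nat.nth (IsSwitch c) (k + 1)) := Nat.nth_mem_of_infinite hc (k + 1)
  have hlt : Nat.nth (IsSwitch c) k < Nat.nth (IsSwitch c) (k + 1) :=
    Nat.nth_strictMono hc k.lt_succ_self
  have hconst : lastSome c (Nat.nth (IsSwitch c) (k + 1)) =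
      lastSome c (Nat.nth (IsSwitch c) k + 1) := by
    refine lastSome_eq_of_forall_not_isSwitch hlt fun i hi hik hs => ?_
    have := Nat.le_nth_of_lt_nth_succ hik hs
    omega
  obtain ⟨a, ha⟩ := Option.ne_none_iff_exists'.1 (lastSome_ne_none_of_isSwitch h1)
  obtain ⟨b, hb⟩ := Option.ne_none_iff_exists'.1 (lastSome_ne_none_of_isSwitch h2)
  have h2' : lastSome c (_ + 1) ≠ lastSome c _ := h2
  rw [hconst, ha, hb] at h2'
  unfold switchSeq
  rw [ha, hb]
  simpa [eq_comm] using h2'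

lemma switchSeq_congr [Inhabited α] [DecidableEq α] {c d : ℕ → Option α}
    (hc : (Set.ofPred (IsSwitch c)).Infinite) (k : ℕ)
    (h : ∀ i < Nat.nth (IsSwitch c) k + 1, c i = d i) : switchSeq d k = switchSeq c k := by
  set m := Nat.nth (IsSwitch c) k with hm
  have hl := lastSome_congr h
  have hs : ∀ i ≤ m, IsSwitch c i ↔ IsSwitch d i := fun i hi => by
    unfold IsSwitch
    rw [hl i (by omega), hl (i + 1) (by omega)]
  have hcm : IsSwitch c m := Nat.nth_mem_of_infinite hc k
  have hcount : Nat.count (IsSwitch d) m = k := by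
    rw [← Nat.count_nth_of_infinite hc k, ← hm, Nat.count_eq_card_filter_range,
      Nat.count_eq_card_filter_range]
    congr 1
    refine Finset.filter_congr fun i hi => (hs i ?_).symm
    have := Finset.mem_range.1 hi
    omega
  have hn : Nat.nth (IsSwitch d) k = m := by
    rw [← hcount]
    exact Nat.nth_count ((hs m le_rfl).1 hcm)
  unfold switchSeq
  rw [hn, ← hm, hl (m + 1) le_rfl]

lemma nth_count_add {p : ℕ → Prop} [DecidablePred p] (hp : (Set.ofPred p).Infinite) (K a : ℕ) :
    Nat.nth p (Nat.count p K + a) = K + Nat.nth (fun i => p (K + i)) a := by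
  have hq : (Set.ofPred fun i => p (K + i)).Infinite := by
    rw [Set.infinite_iff_exists_gt] at hp ⊢
    intro b
    obtain ⟨n, hn, hbn⟩ := hp (K + b)
    refine ⟨n - K, ?_, by omega⟩
    change p (K + (n - K))
    rwa [Nat.add_sub_cancel' (by omega)]
  have hmem := Nat.nth_mem_of_infinite hq a
  have hcount : Nat.count p (K + Nat.nth (fun i => p (K + i)) a) = Nat.count p K + a := by
    rw [Nat.count_add, Nat.count_nth_of_infinite hq]
  rw [← hcount]
  exact Nat.nth_count hmem

lemma etail_switchSeq [Inhabited α] [DecidableEq α] {c d : ℕ → Option α}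
    (hc : (Set.ofPred (IsSwitch c)).Infinite) (hd : (Set.ofPred (IsSwitch d)).Infinite)
    (h : E0 c d) : Etail (switchSeq c) (switchSeq d) := by
  obtain ⟨N, hN⟩ := h
  obtain ⟨n, hn, hNn⟩ := Set.infinite_iff_exists_gt.1 hc N
  have hcn : c n ≠ none := fun h0 => hn (by simp [lastSome, h0])
  have hl : ∀ i, lastSome c (n + 1 + i) = lastSome d (n + 1 + i) := by
    intro i
    induction i with
    | zero =>
      obtain ⟨a, ha⟩ := Option.ne_none_iff_exists'.1 hcn
      simp [lastSome, ← hN n hNn, ha]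
    | succ i ih =>
      change (c (n + 1 + i)).or (lastSome c (n + 1 + i)) =
        (d (n + 1 + i)).or (lastSome d (n + 1 + i))
      rw [hN (n + 1 + i) (by omega), ih]
  have hs : (fun i => IsSwitch c (n + 1 + i)) = fun i => IsSwitch d (n + 1 + i) := by
    funext i
    unfold IsSwitch
    rw [hl i, add_assoc _ i 1, hl (i + 1)]
  refine ⟨Nat.count (IsSwitch c) (n + 1), Nat.count (IsSwitch d) (n + 1), fun a => ?_⟩
  unfold switchSeq
  rw [nth_count_add hc, nth_count_add hd, hs, add_assoc (n + 1), hl]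

/-- If `c` takes no value but `u n` on the `n`-th interval `[L n, L (n + 1))`, takes it at the left
endpoint, and `u` has no consecutive repetitions, then `switchSeq c = u`. -/
lemma switchSeq_eq_of_blocks [Inhabited α] [DecidableEq α] {c : ℕ → Option α} {L : ℕ → ℕ}
    {u : ℕ → α} (hL : StrictMono L) (hu : ∀ n, u n ≠ u (n + 1)) (h0 : ∀ m < L 0, c m = none)
    (hstart : ∀ n, c (L n) = some (u n))
    (hblock : ∀ n m, L n ≤ m → m < L (n + 1) → c m = none ∨ c m = some (u n)) :
    switchSeq c = u := by
  have hlast : ∀ n m, L n < m → m ≤ L (n + 1) → lastSome c m = some (u n) := by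
    intro n m hm
    induction m, hm using Nat.le_induction with
    | base => intro _; simp [lastSome, hstart]
    | succ m hm ih =>
      intro hm'
      rcases hblock n m (by omega) (by omega) with h | h <;> simp [lastSome, h, ih (by omega)]
  have hlast0 : ∀ m ≤ L 0, lastSome c m = none := by
    intro m
    induction m with
    | zero => intro _; rfl
    | succ m ih => intro hm; simp [lastSome, h0 m (by omega), ih (by omega)]
  have hinit : ∀ m < L 0, ¬IsSwitch c m := fun m hm hs =>
    hs (by rw [hlast0 (m + 1) hm, hlast0 m hm.le])
  have hinside : ∀ n m, L n < m → m < L (n + 1) → ¬IsSwitch c m := fun n m h1 h2 hs =>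
    hs (by rw [hlast n (m + 1) (by omega) h2, hlast n m h1 h2.le])
  have hsw : ∀ n, IsSwitch c (L n) := by
    intro n
    have h1 := hlast n (L n + 1) (by omega) (hL n.lt_succ_self)
    unfold IsSwitch
    rw [h1]
    cases n with
    | zero => rw [hlast0 _ le_rfl]; simp
    | succ n =>
      rw [hlast n _ (hL n.lt_succ_self) le_rfl]
      simpa [eq_comm] using hu n
  have hcount : ∀ n, Nat.count (IsSwitch c) (L n) = n := by
    intro n
    induction n with
    | zero =>
      by_contra hne
      obtain ⟨m, hm, hs⟩ := Nat.count_ne_iff_exists.1 hne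
      exact hinit m hm hs
    | succ n ih =>
      have hlt : L n < L (n + 1) := hL n.lt_succ_self
      obtain ⟨j, hj⟩ := Nat.exists_eq_add_of_le hlt
      have hzero : Nat.count (fun k => IsSwitch c (L n + 1 + k)) j = 0 := by
        by_contra hne
        obtain ⟨m, hm, hs⟩ := Nat.count_ne_iff_exists.1 hne
        exact hinside n _ (by omega) (by omega) hs
      rw [hj, Nat.succ_eq_add_one, Nat.count_add, hzero, Nat.count_succ, ih, if_pos (hsw n)]
  funext k
  have hn : Nat.nth (IsSwitch c) k = L k := by
    conv_lhs => rw [← hcount k]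
    exact Nat.nth_count (hsw k)
  unfold switchSeq
  rw [hn, hlast k _ (by omega) (hL k.lt_succ_self)]
  rfl

end Switch

section OddOut

/-- The index of the entry of `(a, b, c)` that differs from the other two, if there is one. -/
def oddOut (a b c : Bool) : Option (Fin 3) :=
  if b = c then (if a = b then none else some 0) else if a = c then some 1 else some 2

lemma oddOut_map (g : Bool → Bool) (a b c : Bool) :
    oddOut (g a) (g b) (g c) = none ∨ oddOut (g a) (g b) (g c) = oddOut a b c := by
  revert g a b c; decide

/-- The odd-one-out sequence of a triple of sequences. -/
def oddSeq (p : (ℕ → Bool) × (ℕ → Bool) × (ℕ → Bool)) (n : ℕ) : Option (Fin 3) :=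
  oddOut (p.1 n) (p.2.1 n) (p.2.2 n)

lemma infinite_isSwitch_oddSeq {p : (ℕ → Bool) × (ℕ → Bool) × (ℕ → Bool)}
    (hp : p ∈ triplesE0 univ) : (Set.ofPred (IsSwitch (oddSeq p))).Infinite := by
  obtain ⟨-, -, -, h01, h02, h12⟩ := hp
  intro hfin
  obtain ⟨N, hN⟩ := hfin.bddAbove
  have hconst : ∀ n > N, lastSome (oddSeq p) n = lastSome (oddSeq p) (N + 1) := fun n hn =>
    lastSome_eq_of_forall_not_isSwitch hn fun i hi _ hs => by
      have : i ≤ N := hN hs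
      omega
  have hodd : ∀ n > N, oddSeq p n = none ∨ oddSeq p n = lastSome (oddSeq p) (N + 1) := by
    intro n hn
    have h := hconst (n + 1) (by omega)
    simp only [lastSome] at h ⊢
    cases h' : oddSeq p n with
    | none => exact Or.inl rfl
    | some a => right; rw [← h, h']; rfl
  generalize lastSome (oddSeq p) (N + 1) = o at hodd
  have key : ∀ o : Option (Fin 3),
      (∀ a b c : Bool, oddOut a b c = none ∨ oddOut a b c = o → a = b) ∨
      (∀ a b c : Bool, oddOut a b c = none ∨ oddOut a b c = o → a = c) ∨
      (∀ a b c : Bool, oddOut a b c = none ∨ oddOut a b c = o → b = c) := by decide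
  rcases key o with h | h | h
  · exact h01 ⟨N, fun n hn => h _ _ _ (hodd n hn)⟩
  · exact h02 ⟨N, fun n hn => h _ _ _ (hodd n hn)⟩
  · exact h12 ⟨N, fun n hn => h _ _ _ (hodd n hn)⟩

lemma continuousOn_switchSeq_oddSeq :
    ContinuousOn (fun p => switchSeq (oddSeq p)) (triplesE0 univ) := by
  refine continuousOn_pi.2 fun k p hp => ContinuousAt.continuousWithinAt ?_
  have hc := infinite_isSwitch_oddSeq hp
  have hcoord : ∀ i, ∀ᶠ q in nhds p, oddSeq p i = oddSeq q i := by
    intro i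
    have hcont : Continuous fun q : (ℕ → Bool) × (ℕ → Bool) × (ℕ → Bool) =>
        (q.1 i, q.2.1 i, q.2.2 i) := by fun_prop
    filter_upwards [((isOpen_discrete {(p.1 i, p.2.1 i, p.2.2 i)}).preimage hcont).mem_nhds rfl]
      with q hq
    simp only [mem_preimage, mem_singleton_iff, Prod.mk.injEq] at hq
    simp [oddSeq, hq]
  have hall : ∀ᶠ q in nhds p, ∀ i ∈ Set.Iio (Nat.nth (IsSwitch (oddSeq p)) k + 1),
      oddSeq p i = oddSeq q i :=
    (Filter.eventually_all_finite (Set.finite_Iio _)).2 fun i _ => hcoord i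
  have heq : (fun q => switchSeq (oddSeq q) k) =ᶠ[nhds p] fun _ => switchSeq (oddSeq p) k := by
    filter_upwards [hall] with q hq
    exact switchSeq_congr hc k hq
  exact continuousAt_const.congr heq.symm

lemma e0_oddSeq {x y z x' y' z' : ℕ → Bool} (hx : E0 x x') (hy : E0 y y') (hz : E0 z z') :
    E0 (oddSeq (x, y, z)) (oddSeq (x', y', z')) := by
  obtain ⟨n, hn⟩ := hx
  obtain ⟨m, hm⟩ := hy
  obtain ⟨l, hl⟩ := hz
  refine ⟨n + m + l, fun k hk => ?_⟩
  simp only [oddSeq]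
  rw [hn k (by omega), hm k (by omega), hl k (by omega)]

end OddOut

section Blocks

variable {s : List Bool} {v : ℕ → Bool → List Bool}

/-- The position at which the `n`-th block starts. -/
def blockStart (s : List Bool) (v : ℕ → Bool → List Bool) (n : ℕ) : ℕ :=
  (blockPrefix s v (fun _ => false) n).length

lemma length_blockPrefix (hv : IsE0Blocks v) (x : ℕ → Bool) (n : ℕ) :
    (blockPrefix s v x n).length = blockStart s v n := by
  unfold blockStart
  induction n with
  | zero => rfl
  | succ n ih =>
    simp only [blockPrefix, List.length_append, ih]
    cases x n <;> simp [hv.2 n]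

lemma strictMono_blockStart (hv : IsE0Blocks v) : StrictMono (blockStart s v) := by
  refine strictMono_nat_of_lt_succ fun n => ?_
  have h := hv.1 n false
  have : v n false ≠ [] := by rintro h0; simp [h0] at h
  simpa [blockStart, blockPrefix] using List.length_pos_iff.2 this

lemma blockPrefix_prefix (x : ℕ → Bool) {m n : ℕ} (h : m ≤ n) :
    blockPrefix s v x m <+: blockPrefix s v x n := by
  induction n, h using Nat.le_induction with
  | base => exact List.prefix_rfl
  | succ n _ ih => exact ih.trans (List.prefix_append _ _)

lemma e0TreeMapOf_eq_getD (hv : IsE0Blocks v) (x : ℕ → Bool) {m n : ℕ}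
    (h : m < blockStart s v n) :
    e0TreeMapOf s v x m = (blockPrefix s v x n).getD m false := by
  have key : ∀ {i j : ℕ}, i ≤ j → m < blockStart s v i →
      (blockPrefix s v x j).getD m false = (blockPrefix s v x i).getD m false := by
    intro i j hij hm
    obtain ⟨t, ht⟩ := blockPrefix_prefix (s := s) (v := v) x hij
    rw [← ht, List.getD_append _ _ _ _ (by rwa [length_blockPrefix hv])]
  unfold e0TreeMapOf
  rcases le_total n (m + 1) with hn | hn
  · exact key hn h
  · exact (key hn ((strictMono_blockStart hv).le_apply (x := m + 1))).symm

lemma e0TreeMapOf_stem (hv : IsE0Blocks v) (x : ℕ → Bool) {m : ℕ} (h : m < blockStart s v 0) :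
    e0TreeMapOf s v x m = s.getD m false :=
  e0TreeMapOf_eq_getD hv x h

lemma e0TreeMapOf_block (hv : IsE0Blocks v) (x : ℕ → Bool) {m n : ℕ}
    (h : blockStart s v n ≤ m) (h' : m < blockStart s v (n + 1)) :
    e0TreeMapOf s v x m = (v n (x n)).getD (m - blockStart s v n) false := by
  rw [e0TreeMapOf_eq_getD hv x h', blockPrefix,
    List.getD_append_right _ _ _ _ (by rwa [length_blockPrefix hv]), length_blockPrefix hv]

lemma e0TreeMapOf_blockStart (hv : IsE0Blocks v) (x : ℕ → Bool) (n : ℕ) :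
    e0TreeMapOf s v x (blockStart s v n) = x n := by
  rw [e0TreeMapOf_block hv x le_rfl (strictMono_blockStart hv n.lt_succ_self), Nat.sub_self,
    List.getD_eq_getElem?_getD, ← List.head?_eq_getElem?, hv.1]
  rfl

lemma not_E0_e0TreeMapOf (hv : IsE0Blocks v) {x y : ℕ → Bool} (h : ¬E0 x y) :
    ¬E0 (e0TreeMapOf s v x) (e0TreeMapOf s v y) := by
  rintro ⟨N, hN⟩
  refine h ⟨N, fun k hk => ?_⟩
  have := hN (blockStart s v k) (lt_of_lt_of_le hk (strictMono_blockStart hv).le_apply)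
  rwa [e0TreeMapOf_blockStart hv, e0TreeMapOf_blockStart hv] at this

lemma not_E0_indicator {u : ℕ → Fin 3} (hu : u ∈ A3) {i j : Fin 3} (hij : i ≠ j) :
    ¬E0 (fun n => decide (u n = i)) (fun n => decide (u n = j)) := by
  rintro ⟨N, hN⟩
  have key : ∀ i j a b : Fin 3, i ≠ j → decide (a = i) = decide (a = j) →
      decide (b = i) = decide (b = j) → a = b := by decide
  exact hu (N + 1) (key i j _ _ hij (hN (N + 1) (by omega)) (hN (N + 2) (by omega)))

lemma exists_switchSeq_oddSeq_eq (hv : IsE0Blocks v) {u : ℕ → Fin 3} (hu : u ∈ A3) :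
    ∃ p ∈ triplesE0 (range (e0TreeMapOf s v)), switchSeq (oddSeq p) = u := by
  let f : Fin 3 → ℕ → Bool := fun i n => decide (u n = i)
  have hodd : ∀ n, oddOut (f 0 n) (f 1 n) (f 2 n) = some (u n) := by
    have key : ∀ a : Fin 3, oddOut (decide (a = 0)) (decide (a = 1)) (decide (a = 2)) = some a := by
      decide
    exact fun n => key (u n)
  have hne : ∀ {i j : Fin 3}, i ≠ j → ¬E0 (e0TreeMapOf s v (f i)) (e0TreeMapOf s v (f j)) :=
    fun hij => not_E0_e0TreeMapOf hv (not_E0_indicator hu hij)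
  refine ⟨(e0TreeMapOf s v (f 0), e0TreeMapOf s v (f 1), e0TreeMapOf s v (f 2)),
    ⟨mem_range_self _, mem_range_self _, mem_range_self _, hne (by decide), hne (by decide),
      hne (by decide)⟩, ?_⟩
  refine switchSeq_eq_of_blocks (L := blockStart s v) (strictMono_blockStart hv) hu ?_ ?_ ?_
  · intro m hm
    simp [oddSeq, e0TreeMapOf_stem hv _ hm, oddOut]
  · intro n
    simp only [oddSeq, e0TreeMapOf_blockStart hv, hodd]
  · intro n m h1 h2
    simp only [oddSeq, e0TreeMapOf_block hv _ h1 h2]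
    rw [← hodd n]
    exact oddOut_map (fun b => (v n b).getD (m - blockStart s v n) false) _ _ _

end Blocks

/-- There is a continuous `P : [2^ω]³_{E₀} → A` which is onto `A` on `[range Φ]³_{E₀}` for
every `E₀`-tree map `Φ`, and which is `E₀`-to-`E³_tail` invariant. -/
theorem exists_P_onto_A3_tail_invariant :
    ∃ P : (ℕ → Bool) × (ℕ → Bool) × (ℕ → Bool) → (ℕ → Fin 3),
      ContinuousOn P (triplesE0 univ) ∧
      (∀ p ∈ triplesE0 univ, P p ∈ A3) ∧
      (∀ Φ : (ℕ → Bool) → (ℕ → Bool), IsE0TreeMap Φ →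
        P '' triplesE0 (range Φ) = A3) ∧
      (∀ x y z x' y' z' : ℕ → Bool,
        (x, y, z) ∈ triplesE0 univ → (x', y', z') ∈ triplesE0 univ →
        E0 x x' → E0 y y' → E0 z z' →
        Etail (P (x, y, z)) (P (x', y', z'))) := by
  have hA : ∀ p ∈ triplesE0 univ, switchSeq (oddSeq p) ∈ A3 := fun p hp =>
    switchSeq_succ_ne (infinite_isSwitch_oddSeq hp)
  refine ⟨fun p => switchSeq (oddSeq p), continuousOn_switchSeq_oddSeq, hA, ?_, ?_⟩
  · rintro Φ ⟨s, v, hv, rfl⟩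
    refine Subset.antisymm ?_ fun u hu => exists_switchSeq_oddSeq_eq hv hu
    rintro _ ⟨p, hp, rfl⟩
    exact hA p ⟨mem_univ _, mem_univ _, mem_univ _, hp.2.2.2⟩
  · intro x y z x' y' z' hp hp' hx hy hz
    exact etail_switchSeq (infinite_isSwitch_oddSeq hp) (infinite_isSwitch_oddSeq hp')
      (e0_oddSeq hx hy hz)
end

section
/- Let D = {(x,y) ∈ ((2^ω)^ω)² : ∃n, x(n)(0) ≠ y(n)(0)}. Then D is a dense open subset of (2^ω)^ω × (2^ω)^ω, and for every Borel set B ⊆ (2^ω)^ω admitting a Borel reduction of E_1 into E_1 ↾ B, [B]²_{E_1} is not contained in D. Hence E_1 does not have the 2-Mycielski property. -/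
open Set Function

/-- The equivalence relation `E₁` on `(2^ω)^ω`: eventual agreement of coordinates. -/
def E1 (x y : ℕ → (ℕ → Bool)) : Prop := ∃ n, ∀ k > n, x k = y k

/-- The dense open set witnessing the failure of the 2-Mycielski property for `E₁`. -/
def D13 : Set ((ℕ → (ℕ → Bool)) × (ℕ → (ℕ → Bool))) :=
  {p | ∃ n, p.1 n 0 ≠ p.2 n 0}

open MeasureTheory Measure Filter Topology
open scoped ENNReal

theorem isOpen_D13 : IsOpen D13 := by
  have : D13 = ⋃ n, {p | p.1 n 0 ≠ p.2 n 0} := by ext; simp [D13]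
  rw [this]
  refine isOpen_iUnion fun n ↦ isOpen_ne_fun ?_ ?_ <;> fun_prop

theorem dense_D13 : Dense D13 := by
  rintro ⟨x, y⟩
  have h : Tendsto (fun n ↦ (x, update y n fun _ ↦ !x n 0)) atTop (𝓝 (x, y)) := by
    refine tendsto_const_nhds.prodMk_nhds (tendsto_pi_nhds.2 fun k ↦ ?_)
    refine tendsto_const_nhds.congr' ?_
    filter_upwards [eventually_gt_atTop k] with n hn
    rw [update_of_ne hn.ne]
  exact mem_closure_of_tendsto h (Eventually.of_forall fun n ↦ ⟨n, by simp⟩)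

/-- Each class of eventual agreement of binary sequences is countable. -/
theorem countable_setOf_eventually_eq (z : ℕ → Bool) :
    {w : ℕ → Bool | ∃ n, ∀ k > n, w k = z k}.Countable := by
  rw [Set.ofPred_exists]
  refine countable_iUnion fun n ↦ Set.Finite.countable ?_
  refine Set.Finite.of_finite_image (f := fun w (i : Fin (n + 1)) ↦ w i) (Set.toFinite _) ?_
  intro w hw w' hw' h
  ext1 k
  rcases lt_or_ge n k with hk | hk
  · exact (hw k hk).trans (hw' k hk).symm
  · exact congrFun h ⟨k, Nat.lt_succ_of_le hk⟩

/-- Lusin's theorem for maps into the Cantor space. -/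
theorem exists_isClosed_continuousOn {X : Type*} [TopologicalSpace X] [MeasurableSpace X]
    [OpensMeasurableSpace X] (μ : Measure X) [IsFiniteMeasure μ] [μ.WeaklyRegular]
    {g : X → ℕ → Bool} (hg : Measurable g) {ε : ℝ≥0∞} (hε : ε ≠ 0) :
    ∃ K, IsClosed K ∧ μ Kᶜ < ε ∧ ContinuousOn g K := by
  obtain ⟨δ, hδ, hδε⟩ := ENNReal.exists_pos_sum_of_countable' hε (ℕ × Bool)
  have hm (p : ℕ × Bool) : MeasurableSet {x | g x p.1 = p.2} :=
    (measurable_pi_iff.1 hg p.1) (measurableSet_singleton p.2)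
  choose F hFs hFc hF using fun p : ℕ × Bool ↦
    (hm p).exists_isClosed_sdiff_lt (measure_ne_top μ _) (hδ p).ne'
  refine ⟨⋂ n, F (n, false) ∪ F (n, true),
    isClosed_iInter fun n ↦ (hFc _).union (hFc _), ?_, ?_⟩
  · refine lt_of_le_of_lt ?_ hδε
    calc μ (⋂ n, F (n, false) ∪ F (n, true))ᶜ
        ≤ μ (⋃ p : ℕ × Bool, {x | g x p.1 = p.2} \ F p) := by
          refine measure_mono fun x hx ↦ ?_
          simp only [mem_compl_iff, mem_iInter, not_forall, mem_union, not_or] at hx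
          obtain ⟨n, h0, h1⟩ := hx
          refine mem_iUnion.2 ⟨(n, g x n), rfl, ?_⟩
          cases h : g x n <;> assumption
      _ ≤ ∑' p, μ ({x | g x p.1 = p.2} \ F p) := measure_iUnion_le _
      _ ≤ ∑' p, δ p := ENNReal.tsum_le_tsum fun p ↦ (hF p).le
  · refine continuousOn_pi.2 fun n ↦ ContinuousOn.mono ?_ (iInter_subset _ n)
    exact ((continuousOn_const (c := false)).congr fun x hx ↦ hFs (n, false) hx).union_of_isClosed
      ((continuousOn_const (c := true)).congr fun x hx ↦ hFs (n, true) hx) (hFc _) (hFc _)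

/-- Resampling one coordinate independently preserves a product probability measure. -/
theorem measurePreserving_update_infinitePi {ι : Type*} [DecidableEq ι] {X : ι → Type*}
    [∀ i, MeasurableSpace (X i)] (μ : ∀ i, Measure (X i)) [∀ i, IsProbabilityMeasure (μ i)]
    (n : ι) :
    MeasurePreserving (fun p : (∀ i, X i) × X n ↦ update p.1 n p.2)
      ((infinitePi μ).prod (μ n)) (infinitePi μ) := by
  have hm : Measurable fun p : (∀ i, X i) × X n ↦ update p.1 n p.2 := by
    refine measurable_pi_iff.2 fun i ↦ ?_
    by_cases h : i = n
    · subst h; simpa using measurable_snd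
    · simp only [update_of_ne h]; fun_prop
  refine ⟨hm, eq_infinitePi μ fun s t ht ↦ ?_⟩
  have hpre : (fun p : (∀ i, X i) × X n ↦ update p.1 n p.2) ⁻¹' Set.pi s t =
      Set.pi (s.erase n) t ×ˢ (if n ∈ s then t n else univ) := by
    ext ⟨x, b⟩
    simp only [mem_preimage, Set.mem_pi, Finset.mem_coe, Finset.mem_erase, mem_prod]
    constructor
    · refine fun h ↦ ⟨fun i hi ↦ by simpa [hi.1] using h i hi.2, ?_⟩
      split_ifs with hn
      · simpa using h n hn
      · trivial
    · rintro ⟨h, hb⟩ i hi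
      by_cases hin : i = n
      · subst hin; simpa [hi] using hb
      · simpa [hin] using h i ⟨hin, hi⟩
  rw [map_apply hm (.pi s.countable_toSet fun i _ ↦ ht i), hpre, prod_prod,
    infinitePi_pi μ fun i _ ↦ ht i]
  split_ifs with hn
  · rw [Finset.prod_erase_mul _ _ hn]
  · rw [Finset.erase_eq_of_notMem hn, measure_univ, mul_one]

section Resampling

variable {α : Type*} [MeasurableSpace α] (ν : Measure α) [IsProbabilityMeasure ν]

theorem ae_ae_update_notMem {N : Set (ℕ → α)} (hN : infinitePi (fun _ ↦ ν) N = 0) (n : ℕ) :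
    ∀ᵐ y ∂infinitePi (fun _ : ℕ ↦ ν), ∀ᵐ b ∂ν, update y n b ∉ N := by
  have h := (measurePreserving_update_infinitePi (fun _ : ℕ ↦ ν) n).quasiMeasurePreserving.ae
    (measure_eq_zero_iff_ae_notMem.1 hN)
  exact ae_ae_of_ae_prod h

theorem measure_eq_zero_of_forall_update {S : Set (ℕ → α)} (hS : MeasurableSet S) (n : ℕ)
    (h : ∀ y, ν {b | update y n b ∈ S} = 0) : infinitePi (fun _ : ℕ ↦ ν) S = 0 := by
  have hp := measurePreserving_update_infinitePi (fun _ : ℕ ↦ ν) n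
  rw [← hp.measure_preimage hS.nullMeasurableSet, measure_prod_null (hp.measurable hS)]
  exact Eventually.of_forall h

/-- Every null set is contained in a null set whose complement is closed under almost every
change of a single coordinate. -/
theorem exists_null_superset_update {N : Set (ℕ → α)}
    (hN : infinitePi (fun _ ↦ ν) N = 0) :
    ∃ M, N ⊆ M ∧ infinitePi (fun _ : ℕ ↦ ν) M = 0 ∧
      ∀ y ∉ M, ∀ n, ∀ᵐ b ∂ν, update y n b ∉ M := by
  let T (S : Set (ℕ → α)) : Set (ℕ → α) := S ∪ {y | ¬∀ n, ∀ᵐ b ∂ν, update y n b ∉ S}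
  have hT {S : Set (ℕ → α)} (hS : infinitePi (fun _ ↦ ν) S = 0) :
      infinitePi (fun _ ↦ ν) (T S) = 0 :=
    measure_union_null hS (ae_all_iff.2 (ae_ae_update_notMem ν hS))
  have hnull (k : ℕ) : infinitePi (fun _ ↦ ν) (T^[k] N) = 0 := by
    induction k with
    | zero => exact hN
    | succ k ih => rw [iterate_succ_apply']; exact hT ih
  refine ⟨⋃ k, T^[k] N, subset_iUnion (fun k ↦ T^[k] N) 0, measure_iUnion_null hnull,
    fun y hy n ↦ ?_⟩
  simp only [mem_iUnion, not_exists] at hy ⊢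
  refine ae_all_iff.2 fun k ↦ ?_
  have := hy (k + 1)
  rw [iterate_succ_apply'] at this
  exact not_not.1 (fun h ↦ this (Or.inr fun h' ↦ h (h' n)))

/-- If changing the coordinate `n` only leads to countably many values of `g`, then almost every
point of `K` keeps its value under a nonnegligible set of changes staying in `K`. -/
theorem measure_setOf_update_eq_null {β : Type*} [MeasurableSpace β] [MeasurableEq β]
    {g : (ℕ → α) → β} (hg : Measurable g)
    {K : Set (ℕ → α)} (hK : MeasurableSet K) (n : ℕ)
    (hc : ∀ y, (range fun b ↦ g (update y n b)).Countable) :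
    infinitePi (fun _ : ℕ ↦ ν)
      {y | y ∈ K ∧ ν {b | update y n b ∈ K ∧ g (update y n b) = g y} = 0} = 0 := by
  have hu := (measurePreserving_update_infinitePi (fun _ : ℕ ↦ ν) n).measurable
  have hm : MeasurableSet {p : (ℕ → α) × α |
      update p.1 n p.2 ∈ K ∧ g (update p.1 n p.2) = g p.1} :=
    (hu hK).inter (measurableSet_eq_fun (hg.comp hu) (hg.comp measurable_fst))
  refine measure_eq_zero_of_forall_update ν
    (hK.inter (measurable_measure_prodMk_left hm (measurableSet_singleton 0))) n fun y ↦ ?_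
  let L (z : β) : Set α := {b | update y n b ∈ K ∧ g (update y n b) = z}
  refine measure_mono_null (t := ⋃ z ∈ {z ∈ range fun b ↦ g (update y n b) | ν (L z) = 0}, L z)
    (fun b hb ↦ ?_) ((measure_biUnion_null_iff (hc y |>.mono (sep_subset _ _))).2 fun z hz ↦ hz.2)
  obtain ⟨hbK, hb0⟩ := hb
  change ν {c | update (update y n b) n c ∈ K ∧
    g (update (update y n b) n c) = g (update y n b)} = 0 at hb0
  simp only [update_idem] at hb0
  exact mem_biUnion (x := g (update y n b)) ⟨⟨b, rfl⟩, hb0⟩ ⟨hbK, rfl⟩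

end Resampling

/-- A Borel map that takes countably many values along each single-coordinate change
identifies two sequences which differ in every coordinate. -/
theorem exists_forall_ne_and_eq_of_countable_range_update {α : Type*} [TopologicalSpace α]
    [TopologicalSpace.PseudoMetrizableSpace α] [SecondCountableTopology α] [MeasurableSpace α]
    [BorelSpace α] (ν : Measure α) [IsProbabilityMeasure ν]
    [NullSingletonClass ν] {g : (ℕ → α) → ℕ → Bool} (hg : Measurable g)
    (hc : ∀ y n, (range fun b ↦ g (update y n b)).Countable) :
    ∃ x y, (∀ n, x n ≠ y n) ∧ g x = g y := by
  obtain ⟨K, hKc, hKμ, hgK⟩ :=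
    exists_isClosed_continuousOn (infinitePi fun _ : ℕ ↦ ν) hg one_ne_zero
  obtain ⟨M, hNM, hM, hMu⟩ := exists_null_superset_update ν (measure_iUnion_null fun n ↦
    measure_setOf_update_eq_null ν hg hKc.measurableSet n fun y ↦ hc y n)
  have hstep (y : ↥(K \ M)) (n : ℕ) :
      ∃ y' : ↥(K \ M), (∀ k ≠ n, y'.1 k = y.1 k) ∧ y'.1 n ≠ y.1 n ∧ g y' = g y := by
    obtain ⟨y, hyK, hyM⟩ := y
    have hpos : ν {b | update y n b ∈ K ∧ g (update y n b) = g y} ≠ 0 :=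
      fun h ↦ hyM (hNM (mem_iUnion.2 ⟨n, hyK, h⟩))
    have hne : ∀ᵐ b ∂ν, b ≠ y n := measure_eq_zero_iff_ae_notMem.1 (measure_singleton (y n))
    obtain ⟨b, ⟨hbK, hbg⟩, hbM, hbn⟩ :=
      ((frequently_ae_iff.2 hpos).and_eventually ((hMu y hyM n).and hne)).exists
    exact ⟨⟨update y n b, hbK, hbM⟩, fun k hk ↦ update_of_ne hk _ _, by simpa using hbn, hbg⟩
  choose step hstep_eq hstep_ne hstep_g using hstep
  obtain ⟨x, hx⟩ : (K \ M).Nonempty := by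
    by_contra! h
    have hKM := sdiff_eq_empty.1 h
    rw [prob_compl_eq_one_sub hKc.measurableSet, measure_mono_null hKM hM] at hKμ
    simp at hKμ
  let s : ℕ → ↥(K \ M) := fun m ↦ Nat.rec ⟨x, hx⟩ (fun n y ↦ step y n) m
  have hs (m : ℕ) : s (m + 1) = step (s m) m := rfl
  have hbefore {m k : ℕ} (h : m ≤ k) : (s m).1 k = x k := by
    induction m with
    | zero => rfl
    | succ m ih => rw [hs, hstep_eq _ _ _ (by omega), ih (by omega)]
  have hafter {m k : ℕ} (h : k < m) : (s m).1 k = (s (k + 1)).1 k := by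
    induction m, h using Nat.le_induction with
    | base => rfl
    | succ m hm ih => rw [hs, hstep_eq _ _ _ (by omega), ih]
  have hsg (m : ℕ) : g (s m).1 = g x := by
    induction m with
    | zero => rfl
    | succ m ih => rw [hs, hstep_g, ih]
  let y : ℕ → α := fun k ↦ (s (k + 1)).1 k
  have hlim : Tendsto (fun m ↦ (s m).1) atTop (𝓝 y) := tendsto_pi_nhds.2 fun k ↦
    tendsto_const_nhds.congr' <| by
      filter_upwards [eventually_gt_atTop k] with m hm using (hafter hm).symm
  have hyK : y ∈ K := hKc.mem_of_tendsto hlim (Eventually.of_forall fun m ↦ (s m).2.1)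
  have hglim := (hgK y hyK).tendsto.comp
    (tendsto_nhdsWithin_iff.2 ⟨hlim, Eventually.of_forall fun m ↦ (s m).2.1⟩)
  refine ⟨x, y, fun n h ↦ hstep_ne (s n) n ?_, ?_⟩
  · rw [hbefore le_rfl, ← hs]
    exact h.symm
  · exact tendsto_nhds_unique (tendsto_const_nhds.congr fun m ↦ (hsg m).symm) hglim

theorem exists_isProbabilityMeasure_nullSingletonClass_cantor :
    ∃ ν : Measure (ℕ → Bool), IsProbabilityMeasure ν ∧ NullSingletonClass ν := by
  have h : ¬Countable unitInterval := by
    rw [← Cardinal.mk_le_aleph0_iff, not_le]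
    exact (Cardinal.mk_Icc_real zero_lt_one).symm ▸ Cardinal.aleph0_lt_continuum
  let e := PolishSpace.measurableEquivNatBoolOfNotCountable h
  refine ⟨volume.map e, isProbabilityMeasure_map e.measurable.aemeasurable, ⟨fun b ↦ ?_⟩⟩
  rw [e.map_apply, ← e.image_symm, image_singleton, measure_singleton]

/-- `E₁` does not have the 2-Mycielski property: `D13` is dense open, yet for every Borel
`B ⊆ (2^ω)^ω` into which `E₁` Borel-reduces (within `B`), `[B]²_{E₁} ⊄ D13`. -/
theorem e1_not_two_mycielski :
    (IsOpen D13 ∧ Dense D13) ∧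
    ∀ B : Set (ℕ → (ℕ → Bool)), MeasurableSet B →
      (∃ f : (ℕ → (ℕ → Bool)) → (ℕ → (ℕ → Bool)),
        Measurable f ∧ range f ⊆ B ∧ ∀ x y, E1 x y ↔ E1 (f x) (f y)) →
      ¬{p : (ℕ → (ℕ → Bool)) × (ℕ → (ℕ → Bool)) |
          p.1 ∈ B ∧ p.2 ∈ B ∧ ¬E1 p.1 p.2} ⊆ D13 := by
  refine ⟨⟨isOpen_D13, dense_D13⟩, fun B _ ⟨f, hf, hfB, hred⟩ hD ↦ ?_⟩
  obtain ⟨ν, _, _⟩ := exists_isProbabilityMeasure_nullSingletonClass_cantor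
  have hg : Measurable fun x n ↦ f x n 0 := by fun_prop
  obtain ⟨x, y, hne, heq⟩ := exists_forall_ne_and_eq_of_countable_range_update ν hg fun y n ↦ by
    refine (countable_setOf_eventually_eq fun n ↦ f y n 0).mono ?_
    rintro _ ⟨b, rfl⟩
    obtain ⟨m, hm⟩ := (hred (update y n b) y).1 ⟨n, fun k hk ↦ update_of_ne hk.ne' _ _⟩
    exact ⟨m, fun k hk ↦ congrFun (hm k hk) 0⟩
  have hxy : ¬E1 x y := fun ⟨n, hn⟩ ↦ hne (n + 1) (hn (n + 1) n.lt_succ_self)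
  obtain ⟨n, hn⟩ := hD (show (f x, f y) ∈ _ from
    ⟨hfB ⟨x, rfl⟩, hfB ⟨y, rfl⟩, fun h ↦ hxy ((hred x y).2 h)⟩)
  exact hn (congrFun heq n)
end

section
/- Let D = {(x,y) ∈ (2^ω)² : ∃i<j (δ_i^j(x,y) > 2 and ∀n (i ≤ n < j → x(n) ≠ y(n)))}. Then: (1) D is dense open in (2^ω)²; (2) for every E_2-tree map Φ, the pair (Φ(0^∞), Φ((01)^∞)) consists of E_2-inequivalent points and does not belong to D; (3) for every Borel set B ⊆ 2^ω admitting a Borel reduction of E_2 into E_2 ↾ B, [B]²_{E_2} is not contained in D. Hence E_2 does not have the 2-Mycielski property. -/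
open Set Function

/-- `δ_m^n(x,y) = Σ {1/(k+1) : m ≤ k < n, x k ≠ y k}`. -/
noncomputable def dE2 (m n : ℕ) (x y : ℕ → Bool) : ℝ :=
  ∑ k ∈ Finset.Ico m n, if x k = y k then 0 else 1 / ((k : ℝ) + 1)

/-- The equivalence relation `E₂`: `x E₂ y` iff `Σ {1/(k+1) : x k ≠ y k} < ∞`. -/
def E2 (x y : ℕ → Bool) : Prop :=
  Summable fun k => if x k = y k then (0 : ℝ) else 1 / ((k : ℝ) + 1)

/-- `δ_m^n` on finite binary strings (read via `getD`). -/
noncomputable def dE2L (m n : ℕ) (a b : List Bool) : ℝ :=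
  ∑ k ∈ Finset.Ico m n, if a.getD k false = b.getD k false then 0 else 1 / ((k : ℝ) + 1)

/-- The `E₂`-tree conditions for `g : 2^{<ω} → 2^{<ω}` with respect to a strictly increasing
sequence `m` with `m 0 = 0`. -/
structure IsE2System (m : ℕ → ℕ) (g : List Bool → List Bool) : Prop where
  mono : StrictMono m
  zero : m 0 = 0
  len : ∀ s, (g s).length = m s.length
  mono_prefix : ∀ s t : List Bool, s <+: t → g s <+: g t
  close : ∀ (k : ℕ) (s t : List Bool), s.length = k + 1 → t.length = k + 1 →
    s.getD k false = t.getD k false →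
    dE2L (m k) (m (k + 1)) (g s) (g t) < 1 / 2 ^ (k + 2)
  far : ∀ (k : ℕ) (s t : List Bool), s.length = k + 1 → t.length = k + 1 →
    s.getD k false ≠ t.getD k false →
    |dE2L (m k) (m (k + 1)) (g s) (g t) - 1 / ((k : ℝ) + 1)| < 1 / 2 ^ (k + 2)

/-- The initial segment `x ↾ n` as a finite string. -/
def seg (x : ℕ → Bool) (n : ℕ) : List Bool := List.ofFn fun i : Fin n => x i

/-- The map `Φ(x) = ⋃ₙ g(x ↾ n)` induced by an `E₂`-tree system. -/
def e2MapOf (g : List Bool → List Bool) (x : ℕ → Bool) : ℕ → Bool :=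
  fun j => (g (seg x (j + 1))).getD j false

/-- `Φ` is an `E₂`-tree map. -/
def IsE2TreeMap (Φ : (ℕ → Bool) → (ℕ → Bool)) : Prop :=
  ∃ m g, IsE2System m g ∧ Φ = e2MapOf g

/-- The constant sequence `0^∞`. -/
def z0 : ℕ → Bool := fun _ => false

/-- The periodic sequence `(01)^∞`. -/
def z01 : ℕ → Bool := fun n => decide (n % 2 = 1)

/-- The dense open set witnessing the failure of the 2-Mycielski property for `E₂`. -/
def D14 : Set ((ℕ → Bool) × (ℕ → Bool)) :=
  {p | ∃ i j, i < j ∧ dE2 i j p.1 p.2 > 2 ∧ ∀ n, i ≤ n → n < j → p.1 n ≠ p.2 n}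

/-! ### Finite partial sums of `E₂` -/

lemma dE2_term_nonneg (x y : ℕ → Bool) (k : ℕ) :
    (0 : ℝ) ≤ if x k = y k then (0 : ℝ) else 1 / ((k : ℝ) + 1) := by
  split_ifs <;> positivity

lemma dE2_nonneg (m n : ℕ) (x y : ℕ → Bool) : 0 ≤ dE2 m n x y :=
  Finset.sum_nonneg fun k _ => dE2_term_nonneg x y k

lemma dE2_comm (m n : ℕ) (x y : ℕ → Bool) : dE2 m n x y = dE2 m n y x := by
  simp only [dE2, eq_comm]

lemma dE2_triangle (m n : ℕ) (x y z : ℕ → Bool) :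
    dE2 m n x z ≤ dE2 m n x y + dE2 m n y z := by
  rw [dE2, dE2, dE2, ← Finset.sum_add_distrib]
  refine Finset.sum_le_sum fun k _ => ?_
  have h : (0 : ℝ) ≤ 1 / ((k : ℝ) + 1) := by positivity
  by_cases h1 : x k = y k <;> by_cases h2 : y k = z k <;> by_cases h3 : x k = z k <;>
    simp_all

lemma dE2_add {m n p : ℕ} (hmn : m ≤ n) (hnp : n ≤ p) (x y : ℕ → Bool) :
    dE2 m n x y + dE2 n p x y = dE2 m p x y :=
  Finset.sum_Ico_consecutive _ hmn hnp

lemma dE2_mono {m n m' n' : ℕ} (hm : m' ≤ m) (hn : n ≤ n') (x y : ℕ → Bool) :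
    dE2 m n x y ≤ dE2 m' n' x y :=
  Finset.sum_le_sum_of_subset_of_nonneg (Finset.Ico_subset_Ico hm hn)
    fun k _ _ => dE2_term_nonneg x y k

lemma dE2_congr {m n : ℕ} {x y x' y' : ℕ → Bool} (hx : ∀ k, m ≤ k → k < n → x k = x' k)
    (hy : ∀ k, m ≤ k → k < n → y k = y' k) : dE2 m n x y = dE2 m n x' y' := by
  refine Finset.sum_congr rfl fun k hk => ?_
  rw [Finset.mem_Ico] at hk
  rw [hx k hk.1 hk.2, hy k hk.1 hk.2]

lemma dE2_le_of_forall_ne {m n : ℕ} {x y : ℕ → Bool} (h : ∀ k, m ≤ k → k < n → x k ≠ y k)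
    (x' y' : ℕ → Bool) : dE2 m n x' y' ≤ dE2 m n x y := by
  refine Finset.sum_le_sum fun k hk => ?_
  rw [Finset.mem_Ico] at hk
  rw [if_neg (h k hk.1 hk.2)]
  split_ifs
  · positivity
  · exact le_rfl

lemma continuous_coord_pair (k : ℕ) :
    Continuous fun p : (ℕ → Bool) × (ℕ → Bool) => (p.1 k, p.2 k) := by
  fun_prop

lemma continuous_dE2 (m n : ℕ) :
    Continuous fun p : (ℕ → Bool) × (ℕ → Bool) => dE2 m n p.1 p.2 := by
  refine continuous_finsetSum _ fun k _ => ?_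
  have h : Continuous fun p : Bool × Bool => if p.1 = p.2 then (0 : ℝ) else 1 / ((k : ℝ) + 1) :=
    continuous_of_discreteTopology
  exact h.comp (continuous_coord_pair k)

/-- The tail `δ_m^ω(x, y)` is at most `c`. -/
def TailLE (m : ℕ) (c : ℝ) (x y : ℕ → Bool) : Prop := ∀ n, dE2 m n x y ≤ c

lemma TailLE.symm {m : ℕ} {c : ℝ} {x y : ℕ → Bool} (h : TailLE m c x y) : TailLE m c y x :=
  fun n => dE2_comm m n x y ▸ h n

lemma TailLE.trans {m : ℕ} {c d : ℝ} {x y z : ℕ → Bool} (h : TailLE m c x y)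
    (h' : TailLE m d y z) : TailLE m (c + d) x z :=
  fun n => (dE2_triangle m n x y z).trans (add_le_add (h n) (h' n))

lemma TailLE.mono {m m' : ℕ} {c : ℝ} {x y : ℕ → Bool} (h : TailLE m c x y) (hm : m ≤ m') :
    TailLE m' c x y :=
  fun n => (dE2_mono hm le_rfl x y).trans (h n)

lemma isClosed_tailLE (m : ℕ) (c : ℝ) :
    IsClosed {p : (ℕ → Bool) × (ℕ → Bool) | TailLE m c p.1 p.2} := by
  simp only [TailLE, ofPred_forall]
  exact isClosed_iInter fun n => isClosed_le (continuous_dE2 m n) continuous_const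

lemma E2_of_tailLE {m : ℕ} {c : ℝ} {x y : ℕ → Bool} (h : TailLE m c x y) : E2 x y := by
  refine summable_of_sum_range_le (c := dE2 0 m x y + c) (dE2_term_nonneg x y) fun n => ?_
  rw [Finset.range_eq_Ico]
  change dE2 0 n x y ≤ _
  calc dE2 0 n x y ≤ dE2 0 (max m n) x y := dE2_mono le_rfl (le_max_right _ _) x y
    _ = dE2 0 m x y + dE2 m (max m n) x y :=
        (dE2_add (Nat.zero_le _) (le_max_left _ _) x y).symm
    _ ≤ _ := by gcongr; exact h _

lemma E2.exists_tailLE {x y : ℕ → Bool} (h : E2 x y) {c : ℝ} (hc : 0 < c) :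
    ∃ m, TailLE m c x y := by
  have ht := h.hasSum.tendsto_sum_nat
  obtain ⟨m, hm⟩ := ((tendsto_order.1 ht).1 _ (sub_lt_self _ hc)).exists
  refine ⟨m, fun n => ?_⟩
  have h1 : dE2 0 (max m n) x y ≤ ∑' k, if x k = y k then (0 : ℝ) else 1 / ((k : ℝ) + 1) :=
    h.sum_le_tsum _ fun k _ => dE2_term_nonneg x y k
  have h2 := dE2_add (Nat.zero_le m) (le_max_left m n) x y
  have h3 : dE2 m n x y ≤ dE2 m (max m n) x y := dE2_mono le_rfl (le_max_right _ _) x y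
  rw [Finset.range_eq_Ico] at hm
  change _ < dE2 0 m x y at hm
  linarith

lemma E2.exists_tailLE_zero {x y : ℕ → Bool} (h : E2 x y) : ∃ n : ℕ, TailLE 0 n x y := by
  obtain ⟨n, hn⟩ := exists_nat_ge (∑' k, if x k = y k then (0 : ℝ) else 1 / ((k : ℝ) + 1))
  exact ⟨n, fun M => (h.sum_le_tsum _ fun k _ => dE2_term_nonneg x y k).trans hn⟩

/-- The harmonic tails are unbounded, so sequences that eventually disagree are inequivalent. -/
lemma not_E2_of_forall_ne {m : ℕ} {x y : ℕ → Bool} (h : ∀ k, m ≤ k → x k ≠ y k) :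
    ¬E2 x y := by
  intro hE
  have hs : Summable fun k : ℕ => 1 / ((k : ℝ) + 1) := by
    refine (summable_nat_add_iff m).1 ?_
    refine ((summable_nat_add_iff m).2 hE).congr fun k => ?_
    rw [if_neg (h _ (Nat.le_add_left m k))]
  exact Real.not_summable_one_div_natCast
    ((summable_nat_add_iff 1).1 (hs.congr fun k => by push_cast; rfl))

lemma E2.exists_eq {x y : ℕ → Bool} (h : E2 x y) (m : ℕ) : ∃ k, m ≤ k ∧ x k = y k := by
  by_contra! hc
  exact not_E2_of_forall_ne hc h

lemma exists_cylinder_subset {V : Set (ℕ → Bool)} (hV : IsOpen V) {x : ℕ → Bool} (hx : x ∈ V) :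
    ∃ n, ∀ y : ℕ → Bool, (∀ k < n, y k = x k) → y ∈ V := by
  obtain ⟨_, ⟨z, n, rfl⟩, hxz, hsub⟩ :=
    (PiNat.isTopologicalBasis_cylinders fun _ : ℕ => Bool).exists_subset_of_mem_open hx hV
  exact ⟨n, fun y hy => hsub fun k hk => (hy k hk).trans (hxz k hk)⟩

lemma isOpen_cylinder (x : ℕ → Bool) (n : ℕ) : IsOpen {y : ℕ → Bool | ∀ k < n, y k = x k} :=
  PiNat.isOpen_cylinder (fun _ : ℕ => Bool) x n

/-! ### The set `D14` -/

lemma isOpen_D14 : IsOpen D14 := by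
  simp only [D14, ofPred_exists]
  refine isOpen_iUnion fun i => isOpen_iUnion fun j => ?_
  simp only [ofPred_and]
  refine isOpen_const.inter ((isOpen_lt continuous_const (continuous_dE2 i j)).inter ?_)
  have : {p : (ℕ → Bool) × (ℕ → Bool) | ∀ n, i ≤ n → n < j → p.1 n ≠ p.2 n} =
      ⋂ n ∈ Finset.Ico i j, {p | p.1 n ≠ p.2 n} := by
    ext p; simp
  rw [this]
  refine isOpen_biInter_finset fun n _ => ?_
  exact (isOpen_discrete {q : Bool × Bool | q.1 ≠ q.2}).preimage
    (continuous_coord_pair n)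

lemma dense_D14 : Dense D14 := by
  rw [dense_iff_inter_open]
  rintro U hU ⟨⟨x, y⟩, hxy⟩
  obtain ⟨V, W, hV, hW, hx, hy, hVW⟩ := isOpen_prod_iff.1 hU x y hxy
  obtain ⟨a, ha⟩ := exists_cylinder_subset hV hx
  obtain ⟨b, hb⟩ := exists_cylinder_subset hW hy
  set c := max a b
  let y' : ℕ → Bool := fun k => if k < c then y k else !x k
  have hne : ∀ k, c ≤ k → x k ≠ y' k := fun k hk => by
    simp [y', not_lt.2 hk]
  refine ⟨(x, y'), hVW ⟨hx, hb _ fun k hk => if_pos (hk.trans_le (le_max_right _ _))⟩, ?_⟩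
  have : ¬TailLE c 2 x y' := fun h => not_E2_of_forall_ne hne (E2_of_tailLE h)
  simp only [TailLE, not_forall, not_le] at this
  obtain ⟨j, hj⟩ := this
  refine ⟨c, j, ?_, hj, fun n hn _ => hne n hn⟩
  by_contra! hcj
  rw [dE2, Finset.Ico_eq_empty_of_le hcj, Finset.sum_empty] at hj
  linarith

lemma notMem_D14_of_tailLE {x y : ℕ → Bool} (h : TailLE 0 2 x y) : (x, y) ∉ D14 := by
  rintro ⟨i, j, -, h2, -⟩
  exact absurd ((dE2_mono (Nat.zero_le i) le_rfl x y).trans (h j)) (not_le.2 h2)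

/-! ### Tree maps -/

lemma seg_length (x : ℕ → Bool) (n : ℕ) : (seg x n).length = n := by simp [seg]

lemma seg_getD {x : ℕ → Bool} {n k : ℕ} (h : k < n) : (seg x n).getD k false = x k := by
  simp [seg, List.getD, h]

lemma seg_prefix (x : ℕ → Bool) {n p : ℕ} (h : n ≤ p) : seg x n <+: seg x p := by
  rw [List.prefix_iff_eq_take]
  apply List.ext_getElem
  · simp [seg, h]
  · intro i h1 h2
    simp [seg]

lemma getD_of_prefix {a b : List Bool} (h : a <+: b) {j : ℕ} (hj : j < a.length) :
    a.getD j false = b.getD j false := by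
  obtain ⟨c, rfl⟩ := h
  rw [List.getD_append _ _ _ _ hj]

section Tree

variable {m : ℕ → ℕ} {g : List Bool → List Bool}

lemma IsE2System.e2MapOf_eq (h : IsE2System m g) (x : ℕ → Bool) {j k : ℕ} (hj : j < m k) :
    e2MapOf g x j = (g (seg x k)).getD j false := by
  have hlen : ∀ n, (g (seg x n)).length = m n := fun n => by rw [h.len, seg_length]
  have hj' : j < m (j + 1) := (Nat.lt_succ_self j).trans_le h.mono.le_apply
  rcases le_total (j + 1) k with hk | hk
  · exact getD_of_prefix (h.mono_prefix _ _ (seg_prefix x hk)) (by rwa [hlen])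
  · exact (getD_of_prefix (h.mono_prefix _ _ (seg_prefix x hk)) (by rwa [hlen])).symm

lemma IsE2System.dE2_block (h : IsE2System m g) (x y : ℕ → Bool) (k : ℕ) :
    dE2 (m k) (m (k + 1)) (e2MapOf g x) (e2MapOf g y) =
      dE2L (m k) (m (k + 1)) (g (seg x (k + 1))) (g (seg y (k + 1))) := by
  refine Finset.sum_congr rfl fun j hj => ?_
  rw [Finset.mem_Ico] at hj
  rw [h.e2MapOf_eq x hj.2, h.e2MapOf_eq y hj.2]

lemma IsE2System.block_close (h : IsE2System m g) {x y : ℕ → Bool} {k : ℕ} (hxy : x k = y k) :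
    dE2 (m k) (m (k + 1)) (e2MapOf g x) (e2MapOf g y) < 1 / 2 ^ (k + 2) := by
  rw [h.dE2_block]
  refine h.close k _ _ (seg_length _ _) (seg_length _ _) ?_
  rwa [seg_getD (Nat.lt_succ_self k), seg_getD (Nat.lt_succ_self k)]

lemma IsE2System.block_far (h : IsE2System m g) {x y : ℕ → Bool} {k : ℕ} (hxy : x k ≠ y k) :
    |dE2 (m k) (m (k + 1)) (e2MapOf g x) (e2MapOf g y) - 1 / ((k : ℝ) + 1)| <
      1 / 2 ^ (k + 2) := by
  rw [h.dE2_block]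
  refine h.far k _ _ (seg_length _ _) (seg_length _ _) ?_
  rwa [seg_getD (Nat.lt_succ_self k), seg_getD (Nat.lt_succ_self k)]

lemma one_div_two_pow_le (k : ℕ) : (1 : ℝ) / 2 ^ (k + 2) ≤ 1 / 2 * (1 / ((k : ℝ) + 1)) := by
  have h : ((k : ℝ) + 1) ≤ 2 ^ (k + 1) := by
    exact_mod_cast (Nat.lt_two_pow_self (n := k + 1)).le
  have h2 : (1 : ℝ) / 2 ^ (k + 2) = 1 / 2 * (1 / 2 ^ (k + 1)) := by
    rw [pow_succ 2 (k + 1)]; field_simp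
  rw [h2]
  gcongr

lemma IsE2System.half_le_block_far (h : IsE2System m g) {x y : ℕ → Bool} {k : ℕ}
    (hxy : x k ≠ y k) :
    1 / 2 * (1 / ((k : ℝ) + 1)) ≤ dE2 (m k) (m (k + 1)) (e2MapOf g x) (e2MapOf g y) := by
  have h1 := (abs_lt.1 (h.block_far hxy)).1
  have h2 := one_div_two_pow_le k
  linarith

lemma z0_eq_z01 (q : ℕ) : z0 (2 * q) = z01 (2 * q) := by simp [z0, z01]

lemma z0_ne_z01 (q : ℕ) : z0 (2 * q + 1) ≠ z01 (2 * q + 1) := by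
  have : (2 * q + 1) % 2 = 1 := by omega
  simp [z0, z01, this]

lemma IsE2System.not_E2 (h : IsE2System m g) : ¬E2 (e2MapOf g z0) (e2MapOf g z01) := by
  intro hE
  obtain ⟨c, hc⟩ := hE.exists_tailLE_zero
  have key : ∀ n, 1 / 4 * ∑ q ∈ Finset.range n, 1 / ((q : ℝ) + 1) ≤
      dE2 0 (m (2 * n)) (e2MapOf g z0) (e2MapOf g z01) := by
    intro n
    induction n with
    | zero => simpa using dE2_nonneg _ _ _ _
    | succ n ih =>
      rw [Finset.sum_range_succ, mul_add]
      have h1 : dE2 0 (m (2 * n)) (e2MapOf g z0) (e2MapOf g z01) +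
          dE2 (m (2 * n)) (m (2 * n + 2)) (e2MapOf g z0) (e2MapOf g z01) =
          dE2 0 (m (2 * (n + 1))) (e2MapOf g z0) (e2MapOf g z01) :=
        dE2_add (Nat.zero_le _) (h.mono.monotone (by omega)) _ _
      have h2 : dE2 (m (2 * n + 1)) (m (2 * n + 2)) (e2MapOf g z0) (e2MapOf g z01) ≤
          dE2 (m (2 * n)) (m (2 * n + 2)) (e2MapOf g z0) (e2MapOf g z01) :=
        dE2_mono (h.mono.monotone (by omega)) le_rfl _ _
      have h3 := h.half_le_block_far (z0_ne_z01 n)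
      have h4 : (1 : ℝ) / 2 * (1 / (((2 * n + 1 : ℕ) : ℝ) + 1)) = 1 / 4 * (1 / ((n : ℝ) + 1)) := by
        push_cast
        field_simp
        ring
      rw [h4] at h3
      have h5 : m (2 * n + 1 + 1) = m (2 * n + 2) := rfl
      rw [h5] at h3
      linarith
  obtain ⟨n, hn⟩ := (Real.tendsto_sum_range_one_div_nat_succ_atTop.eventually_gt_atTop
    (4 * (c : ℝ))).exists
  have h1 := key n
  have h2 := hc (m (2 * n))
  linarith

lemma IsE2System.notMem_D14 (h : IsE2System m g) : (e2MapOf g z0, e2MapOf g z01) ∉ D14 := by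
  rintro ⟨i, j, hij, h2, hne⟩
  dsimp only at h2 hne
  obtain ⟨q, hq1, hq2⟩ : ∃ q, m (2 * q) ≤ i ∧ i < m (2 * q + 2) := by
    have hex : ∃ q, i < m (2 * q + 2) := ⟨i, by
      have := h.mono.le_apply (x := 2 * i + 2); omega⟩
    refine ⟨Nat.find hex, ?_, Nat.find_spec hex⟩
    rcases hn : Nat.find hex with _ | q
    · simp [h.zero]
    · exact not_lt.1 (Nat.find_min hex (m := q) (by omega))
  have hj : j ≤ m (2 * q + 3) := by
    by_contra! hlt
    have h3 : dE2 (m (2 * q + 2)) (m (2 * q + 2 + 1)) (e2MapOf g z0)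
        (e2MapOf g fun _ => true) ≤
        dE2 (m (2 * q + 2)) (m (2 * q + 2 + 1)) (e2MapOf g z0) (e2MapOf g z01) :=
      dE2_le_of_forall_ne (fun k hk1 hk2 => hne k (by omega) (hk2.trans hlt)) _ _
    have h4 := h.half_le_block_far (x := z0) (y := fun _ => true) (k := 2 * q + 2)
      (by simp [z0])
    have h5 := h.block_close (z0_eq_z01 (q + 1))
    have h6 := one_div_two_pow_le (2 * q + 2)
    rw [show 2 * (q + 1) = 2 * q + 2 by ring] at h5
    linarith
  have hle : ∀ k : ℕ, (1 : ℝ) / 2 ^ (k + 2) ≤ 1 / 4 := fun k => by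
    have : (1 : ℝ) / 2 ^ (k + 2) ≤ 1 / 2 ^ 2 := by
      gcongr
      · norm_num
      · omega
    linarith [show (1 : ℝ) / 2 ^ 2 = 1 / 4 by norm_num]
  have b1 := h.block_close (z0_eq_z01 q)
  have b2 := (abs_lt.1 (h.block_far (z0_ne_z01 q))).2
  have b3 := h.block_close (z0_eq_z01 (q + 1))
  have e1 : (1 : ℝ) / (((2 * q + 1 : ℕ) : ℝ) + 1) ≤ 1 := by
    rw [div_le_one (by positivity)]
    exact le_add_of_nonneg_left (Nat.cast_nonneg _)
  have l1 := hle (2 * q)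
  have l2 := hle (2 * q + 1)
  have l3 := hle (2 * (q + 1))
  have s1 : dE2 i j (e2MapOf g z0) (e2MapOf g z01) ≤
      dE2 (m (2 * q)) (m (2 * q + 3)) (e2MapOf g z0) (e2MapOf g z01) := dE2_mono hq1 hj _ _
  have s2 := dE2_add (h.mono.monotone (show 2 * q ≤ 2 * q + 1 by omega))
    (h.mono.monotone (show 2 * q + 1 ≤ 2 * q + 3 by omega)) (e2MapOf g z0) (e2MapOf g z01)
  have s3 := dE2_add (h.mono.monotone (show 2 * q + 1 ≤ 2 * q + 2 by omega))
    (h.mono.monotone (show 2 * q + 2 ≤ 2 * q + 3 by omega)) (e2MapOf g z0) (e2MapOf g z01)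
  have t2 : m (2 * q + 1 + 1) = m (2 * q + 2) := rfl
  have t3 : m (2 * (q + 1)) = m (2 * q + 2) := rfl
  have t4 : m (2 * (q + 1) + 1) = m (2 * q + 3) := rfl
  rw [t2] at b2
  rw [t3, t4] at b3
  linarith

end Tree

/-! ### Translations of Cantor space -/

/-- The group operation of Cantor space. -/
def bxor (x z : ℕ → Bool) : ℕ → Bool := fun k => xor (x k) (z k)

/-- The eventually constant sequence with value `b` off the finite set `F` and `!b` on `F`. -/
def mask (F : Finset ℕ) (b : Bool) : ℕ → Bool := fun k => xor (decide (k ∈ F)) b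

lemma bxor_bxor (x z : ℕ → Bool) : bxor (bxor x z) z = x := by
  funext k; simp [bxor]

lemma continuous_bxor :
    Continuous fun p : (ℕ → Bool) × (ℕ → Bool) => bxor p.1 p.2 := by
  have h : Continuous fun q : Bool × Bool => xor q.1 q.2 := continuous_of_discreteTopology
  exact continuous_pi fun k => h.comp (continuous_coord_pair k)

/-- Translation by `z` as a homeomorphism of Cantor space. -/
def bxorHomeomorph (z : ℕ → Bool) : (ℕ → Bool) ≃ₜ (ℕ → Bool) where
  toFun x := bxor x z
  invFun x := bxor x z
  left_inv x := bxor_bxor x z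
  right_inv x := bxor_bxor x z
  continuous_toFun := continuous_bxor.comp (continuous_id.prodMk continuous_const)
  continuous_invFun := continuous_bxor.comp (continuous_id.prodMk continuous_const)

lemma bxor_mask_singleton_of_lt (x : ℕ → Bool) {k n : ℕ} (h : n < k) :
    bxor x (mask {k} false) n = x n := by
  simp [bxor, mask, h.ne]

lemma exists_invariant_continuousOn {f : (ℕ → Bool) → (ℕ → Bool)} (hf : Measurable f) :
    ∃ C : Set (ℕ → Bool), IsGδ C ∧ Dense C ∧ ContinuousOn f C ∧
      ∀ q ∈ C, ∀ F b, bxor q (mask F b) ∈ C := by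
  have hmeas : ∀ n, MeasurableSet {x | f x n = true} := fun n =>
    (measurable_pi_apply n).comp hf (MeasurableSet.of_discrete (s := {true}))
  choose U hU hUeq using fun n => (hmeas n).residualEq_isOpen
  have hdense : ∀ n, Dense (U n ∪ (closure (U n))ᶜ) := fun n x => by
    rw [closure_union]
    by_cases hx : x ∈ closure (U n)
    · exact Or.inl hx
    · exact Or.inr (subset_closure hx)
  have hres : {x | ∀ n, (f x n = true ↔ x ∈ U n) ∧ x ∈ U n ∪ (closure (U n))ᶜ} ∈
      residual (ℕ → Bool) := by
    refine eventually_countable_forall.2 fun n => ?_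
    refine Filter.Eventually.and ?_
      (residual_of_dense_open ((hU n).union isClosed_closure.isOpen_compl) (hdense n))
    exact (hUeq n).mono fun x hx => iff_of_eq hx
  obtain ⟨C, hCsub, hC, hCd⟩ := mem_residual.1 hres
  have hcont : ContinuousOn f C := by
    refine continuousOn_pi.2 fun n x hx => ?_
    have key : ∀ T : Set (ℕ → Bool), IsOpen T → x ∈ T →
        (∀ y ∈ T, y ∈ C → f y n = f x n) → ContinuousWithinAt (fun y => f y n) C x := by
      intro T hT hxT h
      refine (continuousWithinAt_const (b := f x n)).congr_of_eventuallyEq ?_ rfl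
      filter_upwards [mem_nhdsWithin_of_mem_nhds (hT.mem_nhds hxT), self_mem_nhdsWithin]
        with y hy1 hy2 using h y hy1 hy2
    have hxn := hCsub hx n
    rcases hxn.2 with hxU | hxU
    · exact key _ (hU n) hxU fun y hy hyC => by
        rw [hxn.1.2 hxU, (hCsub hyC n).1.2 hy]
    · refine key _ isClosed_closure.isOpen_compl hxU fun y hy hyC => ?_
      have hno : ∀ w ∈ C, w ∈ (closure (U n))ᶜ → f w n = false := fun w hw hwU => by
        rw [← Bool.not_eq_true]
        exact fun h => hwU (subset_closure ((hCsub hw n).1.1 h))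
      rw [hno y hyC hy, hno x hx hxU]
  refine ⟨⋂ i : Finset ℕ × Bool, bxorHomeomorph (mask i.1 i.2) ⁻¹' C,
    .iInter fun i => hC.preimage (bxorHomeomorph _).continuous,
    dense_iInter_of_Gδ (fun i => hC.preimage (bxorHomeomorph _).continuous)
      fun i => hCd.preimage (bxorHomeomorph _).isOpenMap, hcont.mono fun x hx => ?_, ?_⟩
  · have h : bxor x (mask ∅ false) ∈ C := mem_iInter.1 hx (∅, false)
    have h' : bxor x (mask ∅ false) = x := by funext k; simp [bxor, mask]
    rwa [h'] at h
  · intro q hq F b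
    refine mem_iInter.2 fun i => ?_
    have h : bxor q (mask (symmDiff F i.1) (xor b i.2)) ∈ C :=
      mem_iInter.1 hq (symmDiff F i.1, xor b i.2)
    have h' : bxor (bxor q (mask F b)) (mask i.1 i.2) =
        bxor q (mask (symmDiff F i.1) (xor b i.2)) := by
      funext k
      by_cases h1 : k ∈ F <;> by_cases h2 : k ∈ i.1 <;>
        cases b <;> cases hb : i.2 <;> cases hk : q k <;>
        simp [bxor, mask, Finset.mem_symmDiff, h1, h2, hk]
    change bxor (bxor q (mask F b)) (mask i.1 i.2) ∈ C
    rwa [h']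

lemma exists_forall_eq_of_continuousOn {f : (ℕ → Bool) → (ℕ → Bool)} {C : Set (ℕ → Bool)}
    (hf : ContinuousOn f C) {y : ℕ → Bool} (hy : y ∈ C) (N : ℕ) :
    ∃ n, ∀ y' ∈ C, (∀ k < n, y' k = y k) → ∀ k < N, f y' k = f y k := by
  have h : f ⁻¹' {w | ∀ k < N, w k = f y k} ∈ nhdsWithin y C :=
    hf y hy ((isOpen_cylinder (f y) N).mem_nhds fun _ _ => rfl)
  obtain ⟨u, hu, hyu, hsub⟩ := mem_nhdsWithin.1 h
  obtain ⟨n, hn⟩ := exists_cylinder_subset hu hyu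
  exact ⟨n, fun w hw hwn => hsub ⟨hn w hwn, hw⟩⟩

/-- Baire category on a `Gδ` set: a countable relatively closed cover contains a relatively open
piece. -/
lemma exists_isOpen_inter_subset_of_cover {X : Type*} [TopologicalSpace X] [T2Space X]
    [LocallyCompactSpace X] {S : Set X} (hS : IsGδ S) (hne : S.Nonempty) (F : ℕ → Set X)
    (hF : ∀ n, IsClosed ((↑) ⁻¹' F n : Set S)) (hcov : S ⊆ ⋃ n, F n) :
    ∃ n U, IsOpen U ∧ (U ∩ S).Nonempty ∧ U ∩ S ⊆ F n := by
  have := hS.baireSpace_of_t2Space_locallyCompactSpace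
  have := hne.to_subtype
  obtain ⟨n, ⟨x, hx⟩⟩ := nonempty_interior_of_iUnion_of_closed hF <| by
    refine eq_univ_of_forall fun x => ?_
    obtain ⟨n, hn⟩ := mem_iUnion.1 (hcov x.2)
    exact mem_iUnion.2 ⟨n, hn⟩
  obtain ⟨t, hts, ht, hxt⟩ := mem_interior.1 hx
  obtain ⟨U, hU, rfl⟩ := isOpen_induced_iff.1 ht
  exact ⟨n, U, hU, ⟨x, hxt, x.2⟩, fun y hy => hts (show (⟨y, hy.2⟩ : S) ∈ _ from hy.1)⟩

/-! ### Stability under small moves -/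

/-- The sum `Σ {1/(k+1) : z k = 1}` converges to `r`. -/
def HasWeight (z : ℕ → Bool) (r : ℝ) : Prop :=
  (∀ n, dE2 0 n z z0 ≤ r) ∧ ∀ j : ℕ, ∃ n, r - 1 / ((j : ℝ) + 1) < dE2 0 n z z0

lemma hasWeight_of_support {z : ℕ → Bool} {n : ℕ} (h : ∀ k, n ≤ k → z k = false) :
    HasWeight z (dE2 0 n z z0) := by
  refine ⟨fun p => ?_, fun j => ⟨n, sub_lt_self _ (by positivity)⟩⟩
  refine (dE2_mono le_rfl (le_max_right n p) z z0).trans ?_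
  rw [← dE2_add (Nat.zero_le n) (le_max_left n p)]
  have : dE2 n (max n p) z z0 = 0 := Finset.sum_eq_zero fun k hk => by
    rw [if_pos (by rw [h k (Finset.mem_Ico.1 hk).1]; rfl)]
  rw [this, add_zero]

lemma hasWeight_bxor_singleton {z : ℕ → Bool} {n k : ℕ} (h : ∀ i, n ≤ i → z i = false)
    (hk : n ≤ k) :
    HasWeight (bxor z (mask {k} false)) (dE2 0 n z z0 + 1 / ((k : ℝ) + 1)) := by
  have h1 : dE2 0 (k + 1) (bxor z (mask {k} false)) z0 = dE2 0 n z z0 + 1 / ((k : ℝ) + 1) := by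
    rw [← dE2_add (Nat.zero_le k) (Nat.le_succ k), ← dE2_add (Nat.zero_le n) hk]
    have e1 : dE2 0 n (bxor z (mask {k} false)) z0 = dE2 0 n z z0 :=
      dE2_congr (fun i _ hi => bxor_mask_singleton_of_lt z (hi.trans_le hk)) fun _ _ _ => rfl
    have e2 : dE2 n k (bxor z (mask {k} false)) z0 = 0 := Finset.sum_eq_zero fun i hi => by
      rw [Finset.mem_Ico] at hi
      rw [if_pos]
      rw [bxor_mask_singleton_of_lt z hi.2, h i hi.1]
      rfl
    have e3 : dE2 k (k + 1) (bxor z (mask {k} false)) z0 = 1 / ((k : ℝ) + 1) := by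
      simp [dE2, bxor, mask, h k hk, z0]
    rw [e1, e2, e3, add_zero]
  rw [← h1]
  refine hasWeight_of_support fun i hi => ?_
  have : i ≠ k := by omega
  simp [bxor, mask, this, h i (by omega)]

lemma HasWeight.E2_bxor {z : ℕ → Bool} {r : ℝ} (h : HasWeight z r) (q : ℕ → Bool) :
    E2 q (bxor q z) := by
  refine E2_of_tailLE (m := 0) (c := r) fun n => ?_
  convert h.1 n using 1
  refine Finset.sum_congr rfl fun k _ => ?_
  cases hq : q k <;> cases hz : z k <;> simp [bxor, z0, hq, hz]

lemma isGδ_hasWeight : IsGδ {p : (ℕ → Bool) × ℝ | HasWeight p.1 p.2} := by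
  have hc : ∀ n, Continuous fun p : (ℕ → Bool) × ℝ => dE2 0 n p.1 z0 := fun n =>
    (continuous_dE2 0 n).comp (continuous_fst.prodMk continuous_const)
  simp only [HasWeight, ofPred_and, ofPred_forall, ofPred_exists]
  refine IsGδ.inter (isClosed_iInter fun n => isClosed_le (hc n) continuous_snd).isGδ
    (.iInter fun j => (isOpen_iUnion fun n => ?_).isGδ)
  exact isOpen_lt (by fun_prop) (hc n)

section Reduction

variable {f : (ℕ → Bool) → (ℕ → Bool)} {C : Set (ℕ → Bool)}

/-- On some open set meeting `V`, changing one far enough coordinate moves a uniform tail of `f`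
by at most `1/2`. -/
lemma exists_isOpen_stable (hC : IsGδ C) (hCd : Dense C) (hfC : ContinuousOn f C)
    (hinv : ∀ q ∈ C, ∀ F b, bxor q (mask F b) ∈ C)
    (hred : ∀ x y, E2 x y → E2 (f x) (f y)) {V : Set (ℕ → Bool)} (hV : IsOpen V)
    (hVne : V.Nonempty) :
    ∃ W, IsOpen W ∧ (W ∩ V).Nonempty ∧ ∃ m l, ∀ q ∈ W ∩ C, ∀ k, l ≤ k →
      TailLE m (1 / 2) (f q) (f (bxor q (mask {k} false))) := by
  set S : Set ((ℕ → Bool) × (ℕ → Bool) × ℝ) :=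
    {p | p.1 ∈ C ∧ p.1 ∈ V ∧ bxor p.1 p.2.1 ∈ C ∧ HasWeight p.2.1 p.2.2} with hSdef
  have hcx : Continuous fun p : (ℕ → Bool) × (ℕ → Bool) × ℝ => bxor p.1 p.2.1 :=
    continuous_bxor.comp (continuous_fst.prodMk (continuous_fst.comp continuous_snd))
  have hS : IsGδ S :=
    (hC.preimage continuous_fst).inter ((hV.isGδ.preimage continuous_fst).inter
      ((hC.preimage hcx).inter (isGδ_hasWeight.preimage continuous_snd)))
  have hSne : S.Nonempty := by
    obtain ⟨q, hqV, hqC⟩ := hCd.inter_open_nonempty V hV hVne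
    have h0 := hinv q hqC ∅ false
    refine ⟨(q, mask ∅ false, _), hqC, hqV, h0, hasWeight_of_support (n := 0) fun k _ => ?_⟩
    simp [mask]
  obtain ⟨m, U, hU, ⟨⟨q, z, r⟩, hpU, hpS⟩, hUS⟩ := exists_isOpen_inter_subset_of_cover hS hSne
    (fun m => {p | TailLE m (1 / 4) (f p.1) (f (bxor p.1 p.2.1))})
    (fun m => by
      have c1 : Continuous fun p : S => f p.1.1 :=
        hfC.comp_continuous (continuous_fst.comp continuous_subtype_val) fun p => p.2.1
      have c2 : Continuous fun p : S => f (bxor p.1.1 p.1.2.1) :=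
        hfC.comp_continuous (hcx.comp continuous_subtype_val) fun p => p.2.2.2.1
      exact (isClosed_tailLE m (1 / 4)).preimage (c1.prodMk c2))
    (fun p hp => by
      obtain ⟨m, hm⟩ := (hred _ _ (hp.2.2.2.E2_bxor p.1)).exists_tailLE
        (c := 1 / 4) (by norm_num)
      exact mem_iUnion.2 ⟨m, hm⟩)
  obtain ⟨hqC, hqV, -, hz⟩ := hpS
  obtain ⟨V₁, T, hV₁, hT, hqV₁, hzT, hVT⟩ := isOpen_prod_iff.1 hU q (z, r) hpU
  -- replace `z` by a finitely supported sequence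
  obtain ⟨F, n, hFn, hFT⟩ : ∃ F n, (∀ k, n ≤ k → mask F false k = false) ∧
      (mask F false, dE2 0 n (mask F false) z0) ∈ T := by
    obtain ⟨B, I, hB, hI, hzB, hrI, hBI⟩ := isOpen_prod_iff.1 hT z r hzT
    obtain ⟨a, ha⟩ := exists_cylinder_subset hB hzB
    obtain ⟨ρ, hρ, hball⟩ := Metric.isOpen_iff.1 hI r hrI
    obtain ⟨j, hj⟩ := exists_nat_one_div_lt hρ
    obtain ⟨M, hM⟩ := hz.2 j
    have hF : ∀ k < max a M, mask ((Finset.range (max a M)).filter fun k => z k = true) false k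
        = z k := fun k hk => by
      cases h : z k <;> simp [mask, h]
      simpa using hk
    refine ⟨(Finset.range (max a M)).filter fun k => z k = true, max a M, fun k hk => ?_,
      hBI ⟨ha _ fun k hk => hF k (hk.trans_le (le_max_left _ _)), hball ?_⟩⟩
    · have : ¬k < a ∧ ¬k < M := by omega
      simp [mask, this]
    · rw [dE2_congr (x' := z) (y' := z0) (fun k _ hk => hF k hk) fun _ _ _ => rfl,
        Metric.mem_ball, Real.dist_eq, abs_lt]
      have h1 := hz.1 (max a M)
      have h2 := dE2_mono le_rfl (le_max_right a M) z z0 (m := 0)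
      constructor <;> linarith
  obtain ⟨B, I, hB, hI, hFB, hrI, hBI⟩ := isOpen_prod_iff.1 hT _ _ hFT
  obtain ⟨b, hb⟩ := exists_cylinder_subset hB hFB
  obtain ⟨ρ, hρ, hball⟩ := Metric.isOpen_iff.1 hI _ hrI
  obtain ⟨j, hj⟩ := exists_nat_one_div_lt hρ
  obtain ⟨c, hc⟩ := exists_cylinder_subset (hV₁.inter hV) ⟨hqV₁, hqV⟩
  refine ⟨_, isOpen_cylinder q c, ⟨q, fun _ _ => rfl, hqV⟩, m, max (max n b) (max j c), ?_⟩
  rintro q' ⟨hq'c, hq'C⟩ k hk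
  have hmem : ∀ w ∈ C, (∀ k < c, w k = q k) → ∀ z' r', HasWeight z' r' → (z', r') ∈ T →
      bxor w z' ∈ C → TailLE m (1 / 4) (f w) (f (bxor w z')) := fun w hwC hw z' r' hwt hT' hC' =>
    hUS (show (w, z', r') ∈ U ∩ S from
      ⟨hVT ⟨(hc w hw).1, hT'⟩, hwC, (hc w hw).2, hC', hwt⟩)
  have hcancel : bxor (bxor q' (mask {k} false)) (bxor (mask F false) (mask {k} false)) =
      bxor q' (mask F false) := by
    funext i
    simp only [bxor]
    cases q' i <;> cases mask {k} false i <;> cases mask F false i <;> rfl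
  have h1 := hmem q' hq'C hq'c _ _ (hasWeight_of_support hFn) hFT (hinv q' hq'C F false)
  have h2 := hmem (bxor q' (mask {k} false)) (hinv q' hq'C _ _)
    (fun i hi => (bxor_mask_singleton_of_lt q' (by omega)).trans (hq'c i hi)) _ _
    (hasWeight_bxor_singleton hFn (k := k) (by omega))
    (hBI ⟨hb _ fun i hi => bxor_mask_singleton_of_lt _ (by omega), hball ?_⟩)
    (hcancel ▸ hinv q' hq'C F false)
  · rw [hcancel] at h2
    have h3 := h1.trans h2.symm
    norm_num at h3 ⊢
    exact h3
  · have hkj : 1 / ((k : ℝ) + 1) ≤ 1 / ((j : ℝ) + 1) := by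
      have : (j : ℝ) ≤ k := by exact_mod_cast (by omega : j ≤ k)
      gcongr
    have hpos : 0 < 1 / ((k : ℝ) + 1) := by positivity
    rw [Metric.mem_ball, Real.dist_eq, add_sub_cancel_left, abs_of_pos hpos]
    linarith

/-- Walking through small moves produces a point near `y` whose image differs from that of `y` by a
bounded but non-negligible amount. -/
lemma exists_near_tailLE_one (hfC : ContinuousOn f C)
    (hinv : ∀ q ∈ C, ∀ F b, bxor q (mask F b) ∈ C)
    (hred : ∀ x y, E2 (f x) (f y) → E2 x y) {W : Set (ℕ → Bool)} (hW : IsOpen W) {m l : ℕ}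
    (hstable : ∀ q ∈ W ∩ C, ∀ k, l ≤ k →
      TailLE m (1 / 2) (f q) (f (bxor q (mask {k} false))))
    {y : ℕ → Bool} (hyW : y ∈ W) (hyC : y ∈ C) {N : ℕ} (hN : m ≤ N) :
    ∃ y' ∈ W ∩ C, (∀ k < N, f y' k = f y k) ∧ TailLE N 1 (f y) (f y') ∧
      ¬TailLE N (1 / 2) (f y) (f y') := by
  obtain ⟨a, ha⟩ := exists_cylinder_subset hW hyW
  obtain ⟨b, hb⟩ := exists_forall_eq_of_continuousOn hfC hyC N
  set L := max l (max a b)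
  set w : ℕ → ℕ → Bool := fun j => bxor y (mask (Finset.Ico L (L + j)) false) with hw
  have hwC : ∀ j, w j ∈ C := fun j => hinv y hyC _ _
  have hwL : ∀ j, ∀ k < L, w j k = y k := fun j k hk => by
    simp [hw, bxor, mask, not_le.2 hk]
  have hwW : ∀ j, w j ∈ W := fun j => ha _ fun k hk => hwL j k (by omega)
  have hsucc : ∀ j, w (j + 1) = bxor (w j) (mask {L + j} false) := fun j => by
    funext k
    rcases lt_trichotomy k (L + j) with h | rfl | h
    · have h1 : k < L + (j + 1) := by omega
      simp [hw, bxor, mask, h, h1, h.ne]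
    · simp [hw, bxor, mask]
    · have h1 : ¬k < L + (j + 1) := by omega
      have h2 : ¬k < L + j := by omega
      simp [hw, bxor, mask, h1, h2, h.ne']
  have hex : ∃ j, ¬TailLE N (1 / 2) (f y) (f (w j)) := by
    by_contra! hall
    set v := bxor y (mask (Finset.range L) true) with hv
    have hvC : v ∈ C := hinv y hyC _ _
    have hle : TailLE N (1 / 2) (f y) (f v) := fun M => by
      obtain ⟨n, hn⟩ := exists_forall_eq_of_continuousOn hfC hvC M
      have heq : ∀ k < M, f (w n) k = f v k := hn _ (hwC n) fun k hk => by
        have h1 : k < L + n := by omega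
        by_cases h2 : k < L
        · simp [hw, hv, bxor, mask, h2, not_le.2 h2]
        · simp [hw, hv, bxor, mask, h1, h2, not_lt.1 h2]
      rw [dE2_congr (fun _ _ _ => rfl) fun k _ hk => (heq k hk).symm]
      exact hall n M
    refine not_E2_of_forall_ne (m := L) (fun k hk => ?_) (hred _ _ (E2_of_tailLE hle))
    simp [hv, bxor, mask, not_lt.2 hk]
  classical
  refine ⟨w (Nat.find hex), ⟨hwW _, hwC _⟩,
    hb _ (hwC _) fun k hk => hwL _ k (by omega), ?_, Nat.find_spec hex⟩
  rcases h : Nat.find hex with _ | j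
  · have h0 : w 0 = y := by funext k; simp [hw, bxor, mask]
    intro n
    rw [h0]
    have : dE2 N n (f y) (f y) = 0 := Finset.sum_eq_zero fun k _ => if_pos rfl
    rw [this]
    exact zero_le_one
  · have h1 : TailLE N (1 / 2) (f y) (f (w j)) := not_not.1 (Nat.find_min hex (by omega))
    have h2 := (hstable (w j) ⟨hwW j, hwC j⟩ (L + j) (by omega)).mono hN
    rw [← hsucc] at h2
    have h3 := h1.trans h2
    norm_num at h3
    exact h3

end Reduction

lemma notMem_D14_of_glue {a b b' : ℕ → Bool} {N : ℕ} (hab : (a, b) ∉ D14)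
    (hN : a N = b N) (hb : ∀ k < N + 1, b' k = b k) (htail : TailLE (N + 1) 2 a b') :
    (a, b') ∉ D14 := by
  rintro ⟨i, j, hij, h2, hne⟩
  dsimp only at h2 hne
  rcases le_or_gt j (N + 1) with hj | hj
  · refine hab ⟨i, j, hij, ?_, fun n hn hnj => ?_⟩
    · rwa [← dE2_congr (fun _ _ _ => rfl) fun k _ hk => hb k (hk.trans_le hj)]
    · change a n ≠ b n
      rw [← hb n (hnj.trans_le hj)]
      exact hne n hn hnj
  · rcases le_or_gt i N with hi | hi
    · exact hne N hi (by omega) (by rw [hb N (Nat.lt_succ_self N), hN])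
    · exact absurd ((dE2_mono hi le_rfl a b').trans (htail j)) (not_le.2 h2)

/-- A Borel reduction of `E₂` to itself takes some inequivalent pair outside `D14`. -/
lemma exists_not_E2_notMem_D14 {f : (ℕ → Bool) → (ℕ → Bool)} (hf : Measurable f)
    (hred : ∀ x y, E2 x y ↔ E2 (f x) (f y)) :
    ∃ x y, ¬E2 (f x) (f y) ∧ (f x, f y) ∉ D14 := by
  obtain ⟨C, hC, hCd, hfC, hinv⟩ := exists_invariant_continuousOn hf
  by_contra! hcon
  obtain ⟨W, hW, hWne, m, l, hstable⟩ := exists_isOpen_stable hC hCd hfC hinv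
    (fun x y => (hred x y).1) isOpen_univ univ_nonempty
  rw [inter_univ] at hWne
  obtain ⟨x, hxW, hxC⟩ := hCd.inter_open_nonempty W hW hWne
  set R : Set (ℕ → Bool) := {y | (y ∈ C ∧ y ∈ W) ∧ (f x, f y) ∉ D14}
  have hR : IsGδ R := by
    have hK : IsClosed {w : ℕ → Bool | (f x, w) ∉ D14} :=
      isOpen_D14.isClosed_compl.preimage (continuous_const.prodMk continuous_id)
    obtain ⟨K, hKc, hKeq⟩ := continuousOn_iff_isClosed.1 hfC _ hK
    have : R = W ∩ (K ∩ C) := by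
      rw [← hKeq]
      ext y
      simp only [R, mem_ofPred_eq, mem_inter_iff, mem_preimage]
      tauto
    rw [this]
    exact hW.isGδ.inter (hKc.isGδ.inter hC)
  have hRne : R.Nonempty := by
    refine ⟨x, ⟨hxC, hxW⟩, notMem_D14_of_tailLE fun n => ?_⟩
    have : dE2 0 n (f x) (f x) = 0 := Finset.sum_eq_zero fun k _ => if_pos rfl
    rw [this]
    exact zero_le_two
  obtain ⟨n, U, hU, ⟨y₀, hy₀⟩, hUR⟩ := exists_isOpen_inter_subset_of_cover hR hRne
    (fun n => {y | TailLE 0 (n : ℝ) (f x) (f y)})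
    (fun n => by
      have c : Continuous fun y : R => f y :=
        hfC.comp_continuous continuous_subtype_val fun y => y.2.1.1
      exact (isClosed_tailLE 0 (n : ℝ)).preimage (continuous_const.prodMk c))
    (fun y hy => by
      have hE : E2 (f x) (f y) := by
        by_contra h
        exact hy.2 (hcon x y h)
      exact mem_iUnion.2 hE.exists_tailLE_zero)
  set A : Set ℝ := {r | ∃ y ∈ U ∩ R, ∃ M, dE2 0 M (f x) (f y) = r}
  have hA : BddAbove A := ⟨n, by rintro _ ⟨y, hy, M, rfl⟩; exact hUR hy M⟩
  obtain ⟨_, ⟨y, hy, M, rfl⟩, hsup⟩ := exists_lt_of_lt_csSup (s := A)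
    ⟨_, y₀, hy₀, 0, rfl⟩ (sub_lt_self (sSup A) (show (0 : ℝ) < 1 / 8 by norm_num))
  have hyE : E2 (f x) (f y) := E2_of_tailLE (hUR hy)
  obtain ⟨p, hp⟩ := hyE.exists_tailLE (c := 1 / 8) (by norm_num)
  obtain ⟨N, hN, hNeq⟩ := hyE.exists_eq (max (max M m) p)
  obtain ⟨hyU, ⟨hyC, hyW⟩, hyD⟩ := hy
  obtain ⟨y', ⟨⟨hy'U, hy'W⟩, hy'C⟩, heq, hle, hlt⟩ := exists_near_tailLE_one hfC hinv
    (fun x y => (hred x y).2) (hU.inter hW)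
    (fun q hq => hstable q ⟨hq.1.2, hq.2⟩) ⟨hyU, hyW⟩ hyC (N := N + 1) (by omega)
  have hp' : TailLE (N + 1) (1 / 8) (f x) (f y) := hp.mono (by omega)
  have hy' : y' ∈ U ∩ R := by
    refine ⟨hy'U, ⟨hy'C, hy'W⟩, notMem_D14_of_glue hyD hNeq heq fun k => ?_⟩
    exact (hp'.trans hle k).trans (by norm_num)
  simp only [TailLE, not_forall, not_le] at hlt
  obtain ⟨k, hk⟩ := hlt
  have hNk : N + 1 ≤ k := by
    by_contra! h
    rw [dE2, Finset.Ico_eq_empty_of_le h.le, Finset.sum_empty] at hk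
    norm_num at hk
  have s1 : dE2 0 k (f x) (f y') ≤ sSup A := le_csSup hA ⟨y', hy', k, rfl⟩
  have s2 := dE2_add (Nat.zero_le (N + 1)) hNk (f x) (f y')
  have s3 : dE2 0 (N + 1) (f x) (f y') = dE2 0 (N + 1) (f x) (f y) :=
    dE2_congr (fun _ _ _ => rfl) fun i _ hi => heq i hi
  have s4 : dE2 0 M (f x) (f y) ≤ dE2 0 (N + 1) (f x) (f y) := dE2_mono le_rfl (by omega) _ _
  have s5 := dE2_triangle (N + 1) k (f y) (f x) (f y')
  have s6 := hp'.symm k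
  linarith

/-- `E₂` does not have the 2-Mycielski property: `D14` is dense open; for every `E₂`-tree map
`Φ` the pair `(Φ(0^∞), Φ((01)^∞))` is `E₂`-inequivalent and avoids `D14`; hence for every
Borel `B` into which `E₂` Borel-reduces (within `B`), `[B]²_{E₂} ⊄ D14`. -/
theorem e2_not_two_mycielski :
    (IsOpen D14 ∧ Dense D14) ∧
    (∀ Φ : (ℕ → Bool) → (ℕ → Bool), IsE2TreeMap Φ →
      ¬E2 (Φ z0) (Φ z01) ∧ (Φ z0, Φ z01) ∉ D14) ∧
    (∀ B : Set (ℕ → Bool), MeasurableSet B →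
      (∃ f : (ℕ → Bool) → (ℕ → Bool),
        Measurable f ∧ range f ⊆ B ∧ ∀ x y, E2 x y ↔ E2 (f x) (f y)) →
      ¬{p : (ℕ → Bool) × (ℕ → Bool) | p.1 ∈ B ∧ p.2 ∈ B ∧ ¬E2 p.1 p.2} ⊆ D14) := by
  refine ⟨⟨isOpen_D14, dense_D14⟩, ?_, ?_⟩
  · rintro _ ⟨m, g, h, rfl⟩
    exact ⟨h.not_E2, h.notMem_D14⟩
  · rintro B - ⟨f, hf, hB, hred⟩ hsub
    obtain ⟨x, y, hxy, hD⟩ := exists_not_E2_notMem_D14 hf hred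
    exact hD (hsub ⟨hB ⟨x, rfl⟩, hB ⟨y, rfl⟩, hxy⟩)
end
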